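/- arXiv:1509.08495 — 5 statements merged into one kernel-verified Lean document; each statement's English description precedes it below -/
import Mathlib

section
/- Let θ : ℝ → ℝ be a smooth function with θ ≡ 1 on [−1,1] and θ ≡ 0 outside (−2,2). For an integer m ≥ 1 define ξ_m : ℝ → ℂ by ξ_m(y) = (iy)^{-m}(1−θ(y)) for y ≠ 0 and ξ_m(y) = 0 for y ∈ [−1,1]. Then for every nonnegative integer q there exists a constant C > 0 (depending only on θ, m, q) such that: (i) for every ρ ∈ ℝ \ {0} the limit F_m(ρ) = lim_{T→∞} ∫_{−T}^{T} ξ_m(y) e^{iρy} dy exists and satisfies |F_m(ρ)| ≤ C·(1 + |log|ρ||)·(1+|ρ|)^{-q}; (ii) if moreover m ≥ 2, then ξ_m is absolutely integrable and |∫_ℝ ξ_m(y) e^{iρy} dy| ≤ C·(1+|ρ|)^{-q} for every ρ ∈ ℝ. -/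
open MeasureTheory Filter
open scoped ContDiff Topology

/-- A smooth bounded function vanishing on `(-1, 1)` and locally constant near infinity. -/
structure IsHighFrequencyCutoff (χ : ℝ → ℂ) : Prop where
  contDiff : ContDiff ℝ ∞ χ
  eq_zero : ∀ y : ℝ, |y| < 1 → χ y = 0
  bounded : ∃ B, ∀ y, ‖χ y‖ ≤ B
  hasCompactSupport_deriv : HasCompactSupport (deriv χ)

/-- The kernel `y ↦ (iy)^{-m} χ(y)`. -/
noncomputable def highFrequencyKernel (m : ℕ) (χ : ℝ → ℂ) (y : ℝ) : ℂ :=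
  (Complex.I * (y : ℂ)) ^ (-(m : ℤ)) * χ y

theorem deriv_eq_zero_of_eq_zero_near_zero {χ : ℝ → ℂ} (h : ∀ y : ℝ, |y| < 1 → χ y = 0)
    {y : ℝ} (hy : |y| < 1) : deriv χ y = 0 := by
  have hev : χ =ᶠ[𝓝 y] fun _ => 0 := by
    filter_upwards [(isOpen_lt continuous_abs continuous_const).mem_nhds hy] with z hz
    exact h z hz
  rw [hev.deriv_eq, deriv_const]

theorem norm_highFrequencyKernel_le {χ : ℝ → ℂ} {B : ℝ} (hB : ∀ y, ‖χ y‖ ≤ B) (m : ℕ)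
    (y : ℝ) : ‖highFrequencyKernel m χ y‖ ≤ B * (|y| ^ m)⁻¹ := by
  rw [highFrequencyKernel, norm_mul, norm_zpow, norm_mul, Complex.norm_I, one_mul,
    Complex.norm_real, Real.norm_eq_abs, zpow_neg, zpow_natCast, mul_comm]
  gcongr
  exact hB y

namespace IsHighFrequencyCutoff

variable {χ : ℝ → ℂ}

theorem contDiff_deriv (h : IsHighFrequencyCutoff χ) : ContDiff ℝ ∞ (deriv χ) :=
  (contDiff_infty_iff_deriv.1 h.contDiff).2

theorem hasDerivAt (h : IsHighFrequencyCutoff χ) (y : ℝ) : HasDerivAt χ (deriv χ y) y :=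
  (contDiff_infty_iff_deriv.1 h.contDiff).1.differentiableAt.hasDerivAt

theorem cutoff_deriv (h : IsHighFrequencyCutoff χ) : IsHighFrequencyCutoff (deriv χ) where
  contDiff := h.contDiff_deriv
  eq_zero _ hy := deriv_eq_zero_of_eq_zero_near_zero h.eq_zero hy
  bounded := h.hasCompactSupport_deriv.exists_bound_of_continuous h.contDiff_deriv.continuous
  hasCompactSupport_deriv := h.hasCompactSupport_deriv.deriv

/-- The cutoff `ψ` for which `((iy)⁻¹ χ)' = (iy)⁻² ψ`. -/
theorem mul_deriv_sub (h : IsHighFrequencyCutoff χ) :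
    IsHighFrequencyCutoff (fun y : ℝ => Complex.I * (y * deriv χ y - χ y)) := by
  have hofReal : ContDiff ℝ ∞ (fun y : ℝ => (y : ℂ)) := Complex.ofRealCLM.contDiff
  have hd := h.contDiff_deriv
  have hcomp : HasCompactSupport (fun y : ℝ => (y : ℂ) * deriv χ y) :=
    h.hasCompactSupport_deriv.mul_left
  refine ⟨contDiff_const.mul ((hofReal.mul hd).sub h.contDiff), fun y hy => ?_, ?_, ?_⟩
  · simp [h.eq_zero y hy, h.cutoff_deriv.eq_zero y hy]
  · obtain ⟨B, hB⟩ := h.bounded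
    obtain ⟨D, hD⟩ := hcomp.exists_bound_of_continuous (hofReal.mul hd).continuous
    refine ⟨D + B, fun y => ?_⟩
    rw [norm_mul, Complex.norm_I, one_mul]
    exact (norm_sub_le _ _).trans (add_le_add (hD y) (hB y))
  · have hderiv : deriv (fun y : ℝ => Complex.I * (y * deriv χ y - χ y)) =
        fun y : ℝ => Complex.I * y * deriv (deriv χ) y := by
      ext y
      have := ((((hasDerivAt_id y).ofReal_comp.mul (h.cutoff_deriv.hasDerivAt y)).sub
        (h.hasDerivAt y)).const_mul Complex.I).deriv
      refine this.trans ?_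
      simp only [id, Complex.ofReal_one]
      ring
    rw [hderiv]
    exact h.cutoff_deriv.hasCompactSupport_deriv.mul_left

theorem kernel_eq_zero (h : IsHighFrequencyCutoff χ) (m : ℕ) {y : ℝ} (hy : |y| < 1) :
    highFrequencyKernel m χ y = 0 := by
  simp [highFrequencyKernel, h.eq_zero y hy]

theorem hasDerivAt_kernel (h : IsHighFrequencyCutoff χ) (m : ℕ) (y : ℝ) :
    HasDerivAt (highFrequencyKernel m χ)
      (-(m * Complex.I) * highFrequencyKernel (m + 1) χ y
        + highFrequencyKernel m (deriv χ) y) y := by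
  by_cases hy : |y| < 1
  · rw [h.kernel_eq_zero _ hy, h.cutoff_deriv.kernel_eq_zero _ hy]
    have hev : highFrequencyKernel m χ =ᶠ[𝓝 y] fun _ => 0 := by
      filter_upwards [(isOpen_lt continuous_abs continuous_const).mem_nhds hy] with z hz
      exact h.kernel_eq_zero m hz
    simpa using (hasDerivAt_const y (0 : ℂ)).congr_of_eventuallyEq hev
  · have hy0 : y ≠ 0 := by
      rintro rfl
      simp at hy
    have hz : Complex.I * (y : ℂ) ≠ 0 := by simp [hy0]
    have h1 : HasDerivAt (fun y : ℝ => Complex.I * (y : ℂ)) (Complex.I * 1) y :=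
      (hasDerivAt_id y).ofReal_comp.const_mul Complex.I
    have h2 := (hasDerivAt_zpow (-(m : ℤ)) _ (Or.inl hz)).comp y h1
    have h3 := h2.mul (h.hasDerivAt y)
    refine h3.congr_deriv ?_
    have he : (-(m : ℤ) - 1) = -((m + 1 : ℕ) : ℤ) := by push_cast; ring
    simp only [highFrequencyKernel, he, Function.comp]
    push_cast
    ring

theorem continuous_kernel (h : IsHighFrequencyCutoff χ) (m : ℕ) :
    Continuous (highFrequencyKernel m χ) :=
  continuous_iff_continuousAt.2 fun y => (h.hasDerivAt_kernel m y).continuousAt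

theorem hasDerivAt_kernel_one (h : IsHighFrequencyCutoff χ) (y : ℝ) :
    HasDerivAt (highFrequencyKernel 1 χ)
      (highFrequencyKernel 2
        (fun y : ℝ => Complex.I * (y * deriv χ y - χ y)) y) y := by
  refine (h.hasDerivAt_kernel 1 y).congr_deriv ?_
  by_cases hy : |y| < 1
  · simp [highFrequencyKernel, h.eq_zero y hy, h.cutoff_deriv.eq_zero y hy]
  · have hy0 : (y : ℂ) ≠ 0 := by
      intro h0
      simp [Complex.ofReal_eq_zero.1 h0] at hy
    simp only [highFrequencyKernel, zpow_neg, zpow_natCast]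
    field_simp
    push_cast
    ring

theorem integrable_kernel (h : IsHighFrequencyCutoff χ) {m : ℕ} (hm : 2 ≤ m) :
    Integrable (highFrequencyKernel m χ) := by
  obtain ⟨B, hB⟩ := h.bounded
  have hB0 : 0 ≤ B := (norm_nonneg _).trans (hB 0)
  refine (integrable_inv_one_add_sq.const_mul (B * 2)).mono'
    (h.continuous_kernel m).aestronglyMeasurable (Eventually.of_forall fun y => ?_)
  by_cases hy : |y| < 1
  · rw [h.kernel_eq_zero m hy, norm_zero]
    positivity
  · rw [not_lt] at hy
    refine (norm_highFrequencyKernel_le hB m y).trans ?_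
    rw [mul_assoc]
    have h2 : y ^ 2 ≤ |y| ^ m := by
      rw [← sq_abs]
      exact pow_le_pow_right₀ hy hm
    have h1 : 1 ≤ y ^ 2 := by
      rw [← sq_abs]
      exact one_le_pow₀ hy
    gcongr
    rw [← div_eq_mul_inv, inv_eq_one_div, div_le_div_iff₀ (by positivity) (by positivity)]
    linarith

theorem tendsto_kernel_one (h : IsHighFrequencyCutoff χ) {l : Filter ℝ}
    (hl : Tendsto (fun y : ℝ => |y|) l atTop) :
    Tendsto (highFrequencyKernel 1 χ) l (𝓝 0) := by
  obtain ⟨B, hB⟩ := h.bounded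
  refine squeeze_zero_norm (norm_highFrequencyKernel_le hB 1) ?_
  simpa using (tendsto_inv_atTop_zero.comp hl).const_mul B

end IsHighFrequencyCutoff

theorem norm_exp_I_mul_mul (ρ y : ℝ) :
    ‖Complex.exp (Complex.I * (ρ : ℂ) * (y : ℂ))‖ = 1 := by
  have : Complex.I * (ρ : ℂ) * (y : ℂ) = Complex.I * ((ρ * y : ℝ) : ℂ) := by push_cast; ring
  rw [this, Complex.norm_exp_I_mul_ofReal]

theorem hasDerivAt_exp_I_mul_mul (ρ y : ℝ) :
    HasDerivAt (fun y : ℝ => Complex.exp (Complex.I * (ρ : ℂ) * (y : ℂ)))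
      (Complex.I * ρ * Complex.exp (Complex.I * (ρ : ℂ) * (y : ℂ))) y := by
  have := ((hasDerivAt_id y).ofReal_comp.const_mul (Complex.I * (ρ : ℂ))).cexp
  refine this.congr_deriv ?_
  simp only [id, Complex.ofReal_one]
  ring

theorem MeasureTheory.Integrable.mul_exp_I {f : ℝ → ℂ} (hf : Integrable f) (ρ : ℝ) :
    Integrable fun y : ℝ => f y * Complex.exp (Complex.I * (ρ : ℂ) * (y : ℂ)) := by
  refine hf.mul_bdd (c := 1) (by fun_prop) (Eventually.of_forall fun y => ?_)
  rw [norm_exp_I_mul_mul]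

theorem norm_integral_mul_exp_I_le (f : ℝ → ℂ) (ρ : ℝ) :
    ‖∫ y, f y * Complex.exp (Complex.I * (ρ : ℂ) * (y : ℂ))‖ ≤ ∫ y, ‖f y‖ := by
  refine (norm_integral_le_integral_norm _).trans_eq ?_
  simp [norm_exp_I_mul_mul]

/-- `min (2, |x|) ≤ 2 |x|^s` for exponents `s ∈ [0, 1]`. -/
theorem norm_exp_I_mul_sub_one_le_rpow {s : ℝ} (hs0 : 0 ≤ s) (hs1 : s ≤ 1) (x : ℝ) :
    ‖Complex.exp (Complex.I * x) - 1‖ ≤ 2 * |x| ^ s := by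
  rcases le_total |x| 1 with hx | hx
  · have h1 : ‖Complex.exp (Complex.I * x) - 1‖ ≤ |x| := Real.norm_exp_I_mul_ofReal_sub_one_le
    have h2 : |x| ≤ |x| ^ s := by
      rcases (abs_nonneg x).eq_or_lt with h | h
      · rw [← h]; positivity
      · simpa using Real.rpow_le_rpow_of_exponent_ge h hx hs1
    have h3 : 0 ≤ |x| ^ s := by positivity
    linarith
  · have h1 : ‖Complex.exp (Complex.I * x) - 1‖ ≤ 1 + 1 := by
      refine (norm_sub_le _ _).trans_eq ?_
      rw [Complex.norm_exp_I_mul_ofReal, norm_one]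
    have h2 : 1 ≤ |x| ^ s := Real.one_le_rpow hx hs0
    linarith

theorem integral_indicator_Ici_one_abs_rpow {a : ℝ} (ha : a < -1) :
    ∫ y : ℝ, (Set.Ici (1 : ℝ)).indicator (fun t => t ^ a) |y| = 2 * (1 / (-a - 1)) := by
  rw [integral_comp_abs (f := (Set.Ici (1 : ℝ)).indicator (fun t => t ^ a)),
    setIntegral_indicator measurableSet_Ici,
    Set.inter_eq_right.2 (Set.Ici_subset_Ioi.2 one_pos),
    integral_Ici_eq_integral_Ioi, integral_Ioi_rpow_of_lt ha one_pos, Real.one_rpow,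
    neg_div, ← div_neg]
  ring_nf

theorem integrable_indicator_Ici_one_abs_rpow {a : ℝ} (ha : a < -1) :
    Integrable fun y : ℝ => (Set.Ici (1 : ℝ)).indicator (fun t => t ^ a) |y| := by
  by_contra h
  have h0 := integral_undef h
  rw [integral_indicator_Ici_one_abs_rpow ha] at h0
  have : 0 < -a - 1 := by linarith
  have : 0 < 2 * (1 / (-a - 1)) := by positivity
  exact this.ne' h0

namespace IsHighFrequencyCutoff

variable {χ : ℝ → ℂ}

/-- One integration by parts in the Fourier integral of the kernel. -/
theorem I_mul_integral_kernel (h : IsHighFrequencyCutoff χ) {m : ℕ} (hm : 2 ≤ m) (ρ : ℝ) :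
    Complex.I * ρ *
        ∫ y, highFrequencyKernel m χ y * Complex.exp (Complex.I * (ρ : ℂ) * (y : ℂ)) =
      m * Complex.I *
          (∫ y, highFrequencyKernel (m + 1) χ y * Complex.exp (Complex.I * (ρ : ℂ) * (y : ℂ)))
        - ∫ y, highFrequencyKernel m (deriv χ) y *
            Complex.exp (Complex.I * (ρ : ℂ) * (y : ℂ)) := by
  have hi0 := (h.integrable_kernel hm).mul_exp_I ρ
  have hi1 := (h.integrable_kernel (m := m + 1) (by lia)).mul_exp_I ρ
  have hi2 := (h.cutoff_deriv.integrable_kernel hm).mul_exp_I ρ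
  have hparts := integral_mul_deriv_eq_deriv_mul_of_integrable
    (fun y _ => h.hasDerivAt_kernel m y) (fun y _ => hasDerivAt_exp_I_mul_mul ρ y)
    ((hi0.const_mul (Complex.I * ρ)).congr (Eventually.of_forall fun y => by
      simp only [Pi.mul_apply]; ring))
    (((hi1.const_mul (-(m * Complex.I))).add hi2).congr (Eventually.of_forall fun y => by
      simp only [Pi.mul_apply, Pi.add_apply]; ring))
    hi0
  rw [← integral_const_mul, ← integral_const_mul, ← integral_sub (hi1.const_mul _) hi2]
  calc _ = _ := integral_congr_ae (Eventually.of_forall fun y => by ring)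
    _ = _ := hparts
    _ = _ := by
      rw [← integral_neg]
      exact integral_congr_ae (Eventually.of_forall fun y => by ring)

/-- The Fourier integral of an integrable kernel decays rapidly. -/
theorem exists_norm_integral_kernel_le (q : ℕ) :
    ∀ {χ : ℝ → ℂ} (_ : IsHighFrequencyCutoff χ) {m : ℕ} (_ : 2 ≤ m), ∃ C, 0 ≤ C ∧ ∀ ρ : ℝ,
      ‖∫ y, highFrequencyKernel m χ y * Complex.exp (Complex.I * (ρ : ℂ) * (y : ℂ))‖
        ≤ C / (1 + |ρ|) ^ q := by
  induction q with
  | zero =>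
    intro χ h m hm
    refine ⟨∫ y, ‖highFrequencyKernel m χ y‖, by positivity, fun ρ => ?_⟩
    simpa using norm_integral_mul_exp_I_le (highFrequencyKernel m χ) ρ
  | succ q ih =>
    intro χ h m hm
    obtain ⟨C₀, hC₀, h₀⟩ := ih h hm
    obtain ⟨C₁, hC₁, h₁⟩ := ih h (m := m + 1) (by lia)
    obtain ⟨C₂, hC₂, h₂⟩ := ih h.cutoff_deriv hm
    refine ⟨C₀ + (m * C₁ + C₂), by positivity, fun ρ => ?_⟩
    have hparts := congrArg norm (h.I_mul_integral_kernel hm ρ)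
    rw [norm_mul, norm_mul, Complex.norm_I, one_mul, Complex.norm_real, Real.norm_eq_abs] at hparts
    have hle := hparts.trans_le (norm_sub_le _ _)
    rw [norm_mul, norm_mul, Complex.norm_I, mul_one, Complex.norm_natCast] at hle
    have hm1 := mul_le_mul_of_nonneg_left (h₁ ρ) (Nat.cast_nonneg (α := ℝ) m)
    have hsum := add_le_add (h₀ ρ) (hle.trans (add_le_add hm1 (h₂ ρ)))
    rw [pow_succ, ← div_div, le_div_iff₀ (by positivity)]
    calc _ = _ := by ring
      _ ≤ _ := hsum
      _ = _ := by ring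

/-- If the kernel `(iy)⁻² χ` has mean zero, its Fourier integral is `O(|ρ| (1 + |log |ρ||))`. -/
theorem exists_norm_integral_kernel_two_le_log (h : IsHighFrequencyCutoff χ)
    (hmean : ∫ y, highFrequencyKernel 2 χ y = 0) : ∃ C, 0 ≤ C ∧ ∀ ρ : ℝ, ρ ≠ 0 →
      ‖∫ y, highFrequencyKernel 2 χ y * Complex.exp (Complex.I * (ρ : ℂ) * (y : ℂ))‖
        ≤ C * |ρ| * (1 + |Real.log (|ρ|)|) := by
  obtain ⟨B, hB⟩ := h.bounded
  have hB0 : 0 ≤ B := (norm_nonneg _).trans (hB 0)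
  refine ⟨4 * B * Real.exp 1, by positivity, fun ρ hρ => ?_⟩
  have hρ' : 0 < |ρ| := abs_pos.2 hρ
  set ℓ : ℝ := 1 + |Real.log (|ρ|)| with hℓ
  have hℓ1 : 1 ≤ ℓ := by simp [hℓ]
  have hℓ0 : 0 < ℓ := by linarith
  -- the exponent `s = 1 - 1/ℓ` balances `|ρ|^s` against `∫_1^∞ y^(s-2) dy = ℓ`
  set s : ℝ := 1 - 1 / ℓ with hs
  have hinv : 1 / ℓ ≤ 1 := by rw [div_le_one hℓ0]; exact hℓ1
  have hinv0 : 0 < 1 / ℓ := by positivity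
  have hs2 : s - 2 < -1 := by linarith
  have hsub : ∫ y, highFrequencyKernel 2 χ y * Complex.exp (Complex.I * (ρ : ℂ) * (y : ℂ)) =
      ∫ y, highFrequencyKernel 2 χ y *
        (Complex.exp (Complex.I * (ρ : ℂ) * (y : ℂ)) - 1) := by
    have hi := h.integrable_kernel le_rfl
    simp only [mul_sub, mul_one]
    rw [integral_sub (hi.mul_exp_I ρ) hi, hmean, sub_zero]
  have hpow : |ρ| ^ s ≤ Real.exp 1 * |ρ| := by
    have he : |ρ| ^ s = |ρ| ^ (-(1 / ℓ)) * |ρ| := by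
      rw [← Real.rpow_add_one hρ'.ne']
      congr 1
      rw [hs]; ring
    rw [he, Real.rpow_def_of_pos hρ']
    gcongr
    rw [mul_neg, mul_one_div, ← neg_div, div_le_one hℓ0]
    have := neg_le_abs (Real.log (|ρ|))
    linarith
  rw [hsub]
  calc ‖∫ y, highFrequencyKernel 2 χ y * (Complex.exp (Complex.I * (ρ : ℂ) * (y : ℂ)) - 1)‖
      ≤ ∫ y : ℝ, 2 * B * |ρ| ^ s * (Set.Ici (1 : ℝ)).indicator (fun t => t ^ (s - 2)) |y| := by
        refine norm_integral_le_of_norm_le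
          ((integrable_indicator_Ici_one_abs_rpow hs2).const_mul _)
          (Eventually.of_forall fun y => ?_)
        by_cases hy : |y| < 1
        · rw [h.kernel_eq_zero 2 hy, Set.indicator_of_notMem (by simpa using hy)]
          simp
        · rw [not_lt] at hy
          have hy0 : 0 < |y| := by linarith
          have hexp := norm_exp_I_mul_sub_one_le_rpow (s := s) (by linarith) (by linarith) (ρ * y)
          rw [Set.indicator_of_mem (by simpa using hy), norm_mul]
          have harg : Complex.I * (ρ : ℂ) * (y : ℂ) = Complex.I * ((ρ * y : ℝ) : ℂ) := by
            push_cast; ring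
          rw [harg]
          refine (mul_le_mul (norm_highFrequencyKernel_le hB 2 y) hexp (norm_nonneg _)
            (by positivity)).trans_eq ?_
          rw [abs_mul, Real.mul_rpow hρ'.le hy0.le, Real.rpow_sub hy0 s 2, Real.rpow_two]
          field_simp
    _ = 2 * B * |ρ| ^ s * (2 * ℓ) := by
        rw [integral_const_mul, integral_indicator_Ici_one_abs_rpow hs2]
        congr 2
        rw [hs]
        field_simp
        ring
    _ ≤ 2 * B * (Real.exp 1 * |ρ|) * (2 * ℓ) := by gcongr
    _ = 4 * B * Real.exp 1 * |ρ| * ℓ := by ring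

theorem integral_deriv_kernel_one (h : IsHighFrequencyCutoff χ) :
    ∫ y, highFrequencyKernel 2
      (fun y : ℝ => Complex.I * (y * deriv χ y - χ y)) y = 0 := by
  simpa using integral_of_hasDerivAt_of_tendsto h.hasDerivAt_kernel_one
    (h.mul_deriv_sub.integrable_kernel le_rfl)
    (h.tendsto_kernel_one tendsto_abs_atBot_atTop) (h.tendsto_kernel_one tendsto_abs_atTop_atTop)

/-- The principal value Fourier integral of the kernel `(iy)⁻¹ χ`. -/
theorem tendsto_intervalIntegral_kernel_one (h : IsHighFrequencyCutoff χ) {ρ : ℝ} (hρ : ρ ≠ 0) :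
    Tendsto (fun T : ℝ => ∫ y in (-T)..T,
        highFrequencyKernel 1 χ y * Complex.exp (Complex.I * (ρ : ℂ) * (y : ℂ))) atTop
      (𝓝 (-(∫ y, highFrequencyKernel 2 (fun y : ℝ => Complex.I * (y * deriv χ y - χ y)) y *
        Complex.exp (Complex.I * (ρ : ℂ) * (y : ℂ))) / (Complex.I * ρ))) := by
  have hc : Complex.I * (ρ : ℂ) ≠ 0 := by simp [hρ]
  have hbdry : ∀ {u : ℝ → ℝ}, Tendsto (fun T => |u T|) atTop atTop →
      Tendsto (fun T => highFrequencyKernel 1 χ (u T) *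
        Complex.exp (Complex.I * (ρ : ℂ) * (u T : ℂ))) atTop (𝓝 0) := by
    intro u hu
    refine squeeze_zero_norm' (a := fun T => ‖highFrequencyKernel 1 χ (u T)‖) ?_ ?_
    · exact Eventually.of_forall fun T => by rw [norm_mul, norm_exp_I_mul_mul, mul_one]
    · have := (h.tendsto_kernel_one (l := map u atTop) (tendsto_map'_iff.2 hu)).norm
      simpa [Function.comp_def] using this.comp tendsto_map
  have hi := (h.mul_deriv_sub.integrable_kernel le_rfl).mul_exp_I ρ
  have hlim := (((hbdry (u := id) tendsto_abs_atTop_atTop).sub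
    (hbdry (u := fun T => -T) (by simpa using tendsto_abs_atTop_atTop))).sub
    (intervalIntegral_tendsto_integral hi tendsto_neg_atTop_atBot tendsto_id)).div_const
      (Complex.I * (ρ : ℂ))
  rw [sub_self, zero_sub] at hlim
  refine hlim.congr fun T => ?_
  have hparts := intervalIntegral.integral_mul_deriv_eq_deriv_mul (a := -T) (b := T)
    (fun y _ => h.hasDerivAt_kernel_one y) (fun y _ => hasDerivAt_exp_I_mul_mul ρ y)
    ((h.mul_deriv_sub.continuous_kernel 2).intervalIntegrable _ _)
    (Continuous.intervalIntegrable (by fun_prop) _ _)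
  rw [div_eq_iff hc, ← intervalIntegral.integral_mul_const]
  simp only [id]
  refine hparts.symm.trans (intervalIntegral.integral_congr fun y _ => ?_)
  ring

end IsHighFrequencyCutoff

theorem isHighFrequencyCutoff_one_sub {θ : ℝ → ℝ} (hθ : ContDiff ℝ (⊤ : ℕ∞) θ)
    (hθ_one : ∀ y ∈ Set.Icc (-1 : ℝ) 1, θ y = 1) (hθ_zero : ∀ y : ℝ, 2 ≤ |y| → θ y = 0) :
    IsHighFrequencyCutoff fun y => 1 - (θ y : ℂ) := by
  have hsmooth : ContDiff ℝ ∞ (fun y => (θ y : ℂ)) := Complex.ofRealCLM.contDiff.comp hθ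
  have hcomp : HasCompactSupport (fun y => (θ y : ℂ)) := by
    refine HasCompactSupport.intro (isCompact_Icc (a := (-2 : ℝ)) (b := 2)) fun y hy => ?_
    rw [Set.mem_Icc, ← abs_le, not_le] at hy
    simp [hθ_zero y hy.le]
  refine ⟨contDiff_const.sub hsmooth, fun y hy => ?_, ?_, ?_⟩
  · simp [hθ_one y (abs_le.1 hy.le)]
  · obtain ⟨B, hB⟩ := hcomp.exists_bound_of_continuous hsmooth.continuous
    refine ⟨1 + B, fun y => (norm_sub_le _ _).trans ?_⟩
    simpa using hB y
  · have : deriv (fun y => 1 - (θ y : ℂ)) = -deriv (fun y => (θ y : ℂ)) := by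
      ext y
      simp
    rw [this]
    exact hcomp.deriv.neg

/-- A bound `O(1 + |log |ρ||)` together with rapid decay of `|ρ| L(ρ)` gives rapid decay up to
a logarithmic factor. -/
theorem le_log_div_pow_of_le_of_mul_le {C D L ρ : ℝ} (q : ℕ) (hC : 0 ≤ C) (hD : 0 ≤ D)
    (hlog : L ≤ C * (1 + |Real.log (|ρ|)|)) (hdecay : |ρ| * L ≤ D / (1 + |ρ|) ^ q) :
    L ≤ (C * 2 ^ q + D) * (1 + |Real.log (|ρ|)|) / (1 + |ρ|) ^ q := by
  have hℓ : 0 ≤ |Real.log (|ρ|)| := abs_nonneg _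
  rw [le_div_iff₀ (by positivity)]
  rcases le_total |ρ| 1 with h1 | h1
  · have hp : (1 + |ρ|) ^ q ≤ 2 ^ q := by gcongr; linarith
    calc L * (1 + |ρ|) ^ q ≤ C * (1 + |Real.log (|ρ|)|) * (1 + |ρ|) ^ q := by gcongr
      _ ≤ C * (1 + |Real.log (|ρ|)|) * 2 ^ q := by gcongr
      _ ≤ (C * 2 ^ q + D) * (1 + |Real.log (|ρ|)|) := by nlinarith
  · rcases le_total L 0 with hL | hL
    · exact (mul_nonpos_of_nonpos_of_nonneg hL (by positivity)).trans (by positivity)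
    · rw [le_div_iff₀ (by positivity)] at hdecay
      calc L * (1 + |ρ|) ^ q ≤ |ρ| * L * (1 + |ρ|) ^ q := by
            gcongr
            exact le_mul_of_one_le_left hL h1
        _ ≤ D := hdecay
        _ ≤ (C * 2 ^ q + D) * (1 + |Real.log (|ρ|)|) := by
          have : 0 ≤ C * 2 ^ q := by positivity
          nlinarith


/-- Bounds for the inverse Fourier transform of the high-frequency cutoff kernel
`ξ_m(y) = (iy)^{-m}(1 - θ(y))`: the (principal value) inverse Fourier transform exists and
decays rapidly up to a logarithmic correction, and for `m ≥ 2` the kernel is absolutely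
integrable and its inverse Fourier transform decays rapidly. -/
theorem high_frequency_kernel_bounds (θ : ℝ → ℝ) (hθ : ContDiff ℝ (⊤ : ℕ∞) θ)
    (hθ_one : ∀ y ∈ Set.Icc (-1 : ℝ) 1, θ y = 1)
    (hθ_zero : ∀ y : ℝ, 2 ≤ |y| → θ y = 0)
    (m : ℕ) (hm : 1 ≤ m) (q : ℕ)
    (ξ : ℝ → ℂ) (hξ : ∀ y : ℝ, ξ y = (Complex.I * (y : ℂ)) ^ (-(m : ℤ)) * (1 - (θ y : ℂ))) :
    ∃ C > 0,
      (∀ ρ : ℝ, ρ ≠ 0 → ∃ L : ℂ,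
        Tendsto (fun T : ℝ => ∫ y in (-T)..T, ξ y * Complex.exp (Complex.I * (ρ : ℂ) * (y : ℂ)))
            atTop (nhds L)
          ∧ ‖L‖ ≤ C * (1 + |Real.log (|ρ|)|) / (1 + |ρ|) ^ q)
      ∧ (2 ≤ m → Integrable ξ ∧ ∀ ρ : ℝ,
          ‖∫ y : ℝ, ξ y * Complex.exp (Complex.I * (ρ : ℂ) * (y : ℂ))‖ ≤ C / (1 + |ρ|) ^ q) := by
  have hχ := isHighFrequencyCutoff_one_sub hθ hθ_one hθ_zero
  obtain rfl : ξ = highFrequencyKernel m fun y => 1 - (θ y : ℂ) := funext hξ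
  rcases hm.eq_or_lt with rfl | hm2
  · obtain ⟨C, hC, hlog⟩ :=
      hχ.mul_deriv_sub.exists_norm_integral_kernel_two_le_log hχ.integral_deriv_kernel_one
    obtain ⟨D, hD, hdecay⟩ :=
      IsHighFrequencyCutoff.exists_norm_integral_kernel_le q hχ.mul_deriv_sub le_rfl
    refine ⟨C * 2 ^ q + D + 1, by positivity, fun ρ hρ =>
      ⟨_, hχ.tendsto_intervalIntegral_kernel_one hρ, ?_⟩, fun h => by lia⟩
    have hρ' : 0 < |ρ| := abs_pos.2 hρ
    rw [norm_div, norm_neg, norm_mul, Complex.norm_I, one_mul, Complex.norm_real, Real.norm_eq_abs]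
    refine (le_log_div_pow_of_le_of_mul_le q hC hD ?_ ?_).trans
      (by gcongr ?_ * _ / _; exact le_add_of_nonneg_right zero_le_one)
    · rw [div_le_iff₀ hρ']
      exact (hlog ρ hρ).trans_eq (by ring)
    · rw [mul_div_cancel₀ _ hρ'.ne']
      exact hdecay ρ
  · obtain ⟨C, hC, hdecay⟩ := IsHighFrequencyCutoff.exists_norm_integral_kernel_le q hχ hm2
    have hi := hχ.integrable_kernel hm2
    have hle : ∀ ρ : ℝ, C / (1 + |ρ|) ^ q ≤ (C + 1) / (1 + |ρ|) ^ q := fun ρ => by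
      gcongr
      exact le_add_of_nonneg_right zero_le_one
    refine ⟨C + 1, by positivity, fun ρ _ => ⟨_, intervalIntegral_tendsto_integral
      (hi.mul_exp_I ρ) tendsto_neg_atTop_atBot tendsto_id, ?_⟩,
      fun _ => ⟨hi, fun ρ => (hdecay ρ).trans (hle ρ)⟩⟩
    refine ((hdecay ρ).trans (hle ρ)).trans ?_
    gcongr
    exact le_mul_of_one_le_right (by positivity) (le_add_of_nonneg_right (abs_nonneg _))
end

section
/- Let a > 0, B ≥ 0, D ≥ 0 and r₀ > 0. Let h : [r₀,∞) → ℝ be continuously differentiable and g : [r₀,∞) → [0,∞) be integrable with ∫_{r₀}^∞ g(s) ds ≤ D. Assume that h'(r) ≥ −B·r^{−1−a}·|h(r)| − g(r) for all r ≥ r₀, and that (1/r)·∫_r^{2r} |h(s)| ds → 0 as r → ∞. Then h(r) ≤ e^{B·r₀^{−a}/a} · D for every r ≥ r₀. -/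
open MeasureTheory Set Filter

/-- The integrating factor `exp (-B r^{-a} / a)` for the coefficient `B r^{-1-a}`. -/
lemma hasDerivAt_exp_neg_rpow {a r : ℝ} (B : ℝ) (ha : 0 < a) (hr : 0 < r) :
    HasDerivAt (fun x : ℝ => Real.exp (-(B * x ^ (-a) / a)))
      (Real.exp (-(B * r ^ (-a) / a)) * (B * r ^ (-1 - a))) r := by
  have hpow := Real.hasDerivAt_rpow_const (x := r) (p := -a) (Or.inl hr.ne')
  refine (((hpow.const_mul B).div_const a).fun_neg).exp.congr_deriv ?_
  rw [show -a - 1 = -1 - a by ring]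
  field_simp

/-- On an interval where `h` is positive, the product of `h` with the integrating factor
decreases by at most `∫ g`. -/
lemma exp_neg_rpow_mul_sub_le_integral {a B p q : ℝ} {h h' g : ℝ → ℝ}
    (ha : 0 < a) (hB : 0 ≤ B) (hp : 0 < p) (hpq : p ≤ q)
    (hcont : ContinuousOn h (Icc p q))
    (hderiv : ∀ r ∈ Ioo p q, HasDerivWithinAt h (h' r) (Ioi r) r)
    (hg_nonneg : ∀ r ∈ Ioo p q, 0 ≤ g r)
    (hg_int : IntegrableOn g (Icc p q))
    (hineq : ∀ r ∈ Ioo p q, h' r ≥ -B * r ^ (-1 - a) * |h r| - g r)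
    (hpos : ∀ r ∈ Ioo p q, 0 < h r) :
    Real.exp (-(B * p ^ (-a) / a)) * h p - Real.exp (-(B * q ^ (-a) / a)) * h q
      ≤ ∫ s in p..q, g s := by
  have hμ : ∀ r ∈ Icc p q, HasDerivAt (fun x : ℝ => Real.exp (-(B * x ^ (-a) / a)))
      (Real.exp (-(B * r ^ (-a) / a)) * (B * r ^ (-1 - a))) r :=
    fun r hr => hasDerivAt_exp_neg_rpow B ha (hp.trans_le hr.1)
  have key := intervalIntegral.sub_le_integral_of_hasDeriv_right_of_le
    (g := fun x => -(Real.exp (-(B * x ^ (-a) / a)) * h x)) (φ := g) hpq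
    (ContinuousOn.mul (fun r hr => (hμ r hr).continuousAt.continuousWithinAt) hcont).neg
    (fun r hr => ((hμ r (Ioo_subset_Icc_self hr)).hasDerivWithinAt.mul (hderiv r hr)).neg)
    hg_int ?_
  · simpa only [neg_sub_neg] using key
  · intro r hr
    have hr0 : 0 < r := hp.trans hr.1
    have hle : Real.exp (-(B * r ^ (-a) / a)) ≤ 1 := by
      rw [Real.exp_le_one_iff, neg_nonpos]
      positivity
    have hdiff := hineq r hr
    rw [abs_of_pos (hpos r hr)] at hdiff
    have hmul := mul_le_mul_of_nonneg_left hdiff (Real.exp_pos (-(B * r ^ (-a) / a))).le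
    have hg := mul_le_mul_of_nonneg_right hle (hg_nonneg r hr)
    linarith

/-- If the averages of `|h|` over `[r, 2r]` tend to zero, then `h` is not eventually bounded
below by a positive constant. -/
lemma nonpos_of_tendsto_average_abs {h : ℝ → ℝ} {R δ : ℝ}
    (hcont : ContinuousOn h (Ici R)) (hle : ∀ r ∈ Ici R, δ ≤ h r)
    (hdecay : Tendsto (fun r => (1 / r) * ∫ s in r..(2 * r), |h s|) atTop (nhds 0)) :
    δ ≤ 0 := by
  refine ge_of_tendsto hdecay ?_
  filter_upwards [eventually_ge_atTop R, eventually_gt_atTop 0] with r hrR hr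
  have hr2 : r ≤ 2 * r := by linarith
  have hint : IntervalIntegrable (fun s => |h s|) volume r (2 * r) := by
    apply ContinuousOn.intervalIntegrable
    rw [uIcc_of_le hr2]
    exact (hcont.mono fun s hs => hrR.trans hs.1).abs
  have hmono := intervalIntegral.integral_mono_on hr2 (intervalIntegrable_const (c := δ)) hint
    fun s hs => (hle s (hrR.trans hs.1)).trans (le_abs_self _)
  rw [intervalIntegral.integral_const, smul_eq_mul] at hmono
  calc δ = 1 / r * ((2 * r - r) * δ) := by field_simp; ring
    _ ≤ _ := by gcongr

/-- Gronwall-type estimate from data at infinity: if `h` is `C¹` on `[r₀,∞)` with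
`h'(r) ≥ -B r^{-1-a} |h(r)| - g(r)`, `g ≥ 0` with `∫_{r₀}^∞ g ≤ D`, and the averages
`(1/r)∫_r^{2r} |h| → 0` as `r → ∞`, then `h(r) ≤ e^{B r₀^{-a}/a} D` on `[r₀,∞)`. -/
theorem gronwall_from_infinity
    (a B D r₀ : ℝ) (ha : 0 < a) (hB : 0 ≤ B) (hD : 0 ≤ D) (hr₀ : 0 < r₀)
    (h h' g : ℝ → ℝ)
    (hderiv : ∀ r ∈ Ici r₀, HasDerivWithinAt h (h' r) (Ici r₀) r)
    (hderiv_cont : ContinuousOn h' (Ici r₀))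
    (hg_nonneg : ∀ r ∈ Ici r₀, 0 ≤ g r)
    (hg_int : IntegrableOn g (Ici r₀))
    (hg_bound : (∫ s in Ici r₀, g s) ≤ D)
    (hineq : ∀ r ∈ Ici r₀, h' r ≥ -B * r ^ (-1 - a) * |h r| - g r)
    (hdecay : Tendsto (fun r => (1 / r) * ∫ s in r..(2 * r), |h s|) atTop (nhds 0)) :
    ∀ r ∈ Ici r₀, h r ≤ Real.exp (B * r₀ ^ (-a) / a) * D := by
  intro R hR
  by_contra! hlt
  have hcont : ContinuousOn h (Ici r₀) := fun r hr => (hderiv r hr).continuousWithinAt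
  have hR0 : 0 < R := hr₀.trans_le hR
  have hhR : 0 < h R := lt_of_le_of_lt (by positivity) hlt
  have hstart : D < Real.exp (-(B * R ^ (-a) / a)) * h R := by
    have hpow : R ^ (-a) ≤ r₀ ^ (-a) :=
      Real.rpow_le_rpow_of_nonpos hr₀ hR (by linarith)
    calc D = Real.exp (-(B * r₀ ^ (-a) / a)) * (Real.exp (B * r₀ ^ (-a) / a) * D) := by
          rw [← mul_assoc, ← Real.exp_add, neg_add_cancel, Real.exp_zero, one_mul]
      _ < Real.exp (-(B * r₀ ^ (-a) / a)) * h R := by gcongr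
      _ ≤ _ := by gcongr
  have hlower : ∀ q, R ≤ q → (∀ r ∈ Ioo R q, 0 < h r) →
      Real.exp (-(B * R ^ (-a) / a)) * h R - D ≤ Real.exp (-(B * q ^ (-a) / a)) * h q := by
    intro q hq hpos
    have hsub : Icc R q ⊆ Ici r₀ := fun r hr => le_trans hR hr.1
    have hsub' : Ioo R q ⊆ Ici r₀ := Ioo_subset_Icc_self.trans hsub
    have hdec := exp_neg_rpow_mul_sub_le_integral ha hB hR0 hq (hcont.mono hsub)
      (fun r hr => (hderiv r (hsub' hr)).mono (Ioi_subset_Ici (hsub' hr)))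
      (fun r hr => hg_nonneg r (hsub' hr)) (hg_int.mono_set hsub)
      (fun r hr => hineq r (hsub' hr)) hpos
    have hgD : ∫ s in R..q, g s ≤ D := by
      rw [intervalIntegral.integral_of_le hq]
      exact (setIntegral_mono_set hg_int
        ((ae_restrict_iff' measurableSet_Ici).2 (ae_of_all _ hg_nonneg))
        (Ioc_subset_Icc_self.trans hsub).eventuallyLE).trans hg_bound
    linarith
  have hpos : ∀ r ∈ Ici R, 0 < h r := by
    intro T hT
    by_contra! hhT
    have hsub : Icc R T ⊆ Ici r₀ := fun r hr => le_trans hR hr.1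
    have hclosed : IsClosed (Icc R T ∩ h ⁻¹' Iic 0) :=
      (hcont.mono hsub).preimage_isClosed_of_isClosed isClosed_Icc isClosed_Iic
    obtain ⟨q, ⟨hqT, hhq⟩, hleast⟩ :=
      (isCompact_Icc.of_isClosed_subset hclosed inter_subset_left).exists_isLeast
        ⟨T, ⟨hT, le_rfl⟩, hhT⟩
    have hq := hlower q hqT.1 fun r hr => by
      by_contra! hhr
      exact (hleast ⟨⟨hr.1.le, hr.2.le.trans hqT.2⟩, hhr⟩).not_gt hr.2
    have := mul_nonpos_of_nonneg_of_nonpos (Real.exp_pos (-(B * q ^ (-a) / a))).le hhq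
    linarith
  have hle : ∀ r ∈ Ici R, Real.exp (-(B * R ^ (-a) / a)) * h R - D ≤ h r := by
    intro r hr
    have hr0 : 0 < r := hR0.trans_le hr
    refine (hlower r hr fun s hs => hpos s hs.1.le).trans
      (mul_le_of_le_one_left (hpos r hr).le ?_)
    rw [Real.exp_le_one_iff, neg_nonpos]
    positivity
  linarith [nonpos_of_tendsto_average_abs (hcont.mono (Ici_subset_Ici.2 hR)) hle hdecay]
end

section
/- (Rodnianski–Tao ODE dichotomy.) Let a ∈ (0,1], B ≥ 1 and c > 0. There exists C₁⁰ ≥ 1, depending only on (a,B,c), such that for every C₁ ≥ C₁⁰ there exists C₂⁰ ≥ 1, depending only on (a,B,c,C₁), such that for every C₂ ≥ C₂⁰ there exists C₃ ≥ 1, depending only on (a,B,c,C₁,C₂), with the following property. Let ω > 0 and D > 0, let M, F, P : [C₁,∞) → ℝ be continuously differentiable with M(r) > 0 for all r, let G : [C₁,∞) → [0,∞) be integrable with ∫_{C₁}^∞ G ≤ D, and suppose that for all r ≥ C₁: (i) M'(r) = 2F(r); (ii) F'(r) ≥ 2F(r)²/M(r) − P(r) − B·r^{−3}·M(r) − G(r);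 (iii) P'(r) ≥ (2/r)·(1+ε(r))·(F(r)²/M(r) − P(r) + c·ω²·M(r)) − B·r^{−3−a}·M(r) − B·r^{−1−a}·|P(r)| − (1+ω)·G(r) for some function ε with |ε(r)| ≤ B·r^{−1}; (iv) P(r) ≤ B·(D + r^{−2−a}·M(r)); (v) (1/r)·∫_r^{2r} (M(s) + |F(s)| + |P(s)|) ds → 0 as r → ∞. Then at least one of the following two scenarios holds: (1) (boundedness scenario) there exists R₀ with C₁ < R₀ < C₃ such that M(r) ≤ C₃·(ω^{−2C₃} + 1)·D for all r ∈ [R₀/2, 4R₀]; or (2) (exponential growth from infinity scenario) M'(r) ≤ −C₂·(1+ω)·M(r) for all r ∈ [C₁, 10C₁]. -/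
open MeasureTheory Set Filter

/-- The algebraic inequality behind the growth bound for the weighted energy: the flux terms are
absorbed by the Pohozaev terms when `f` lies below a barrier `h`. -/
theorem pohozaev_pointwise {r B ρ f q h c ω f' q' h' e : ℝ} (hr : 1 ≤ r) (hB : 1 ≤ B)
    (hρr : 1 / r ≤ ρ) (hρ : 10 * B * ρ ≤ 1) (hc : 0 ≤ c)
    (hh0 : 0 ≤ h) (hh : h ≤ 2 / r) (hfh : f ≤ h) (hq : q ≤ 2 * B * ρ / r ^ 2)
    (hφ' : h' - f' ≤ q)
    (hq' : q' ≥ 2 / r * ((f ^ 2 - q + c * ω ^ 2) - B / r * |f ^ 2 - q + c * ω ^ 2|)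
      - B * ρ / r ^ 3 - B * ρ / r * |q| - e - 2 * q * f) :
    2 * (h - f) * (h' - f') - q' ≤ -((2 - 3 * B * ρ) / r) * ((h - f) ^ 2 - q + c * ω ^ 2)
      + 4 / r * (h * (h - f)) + 11 * B * ρ / r ^ 3 + e := by
  have hr0 : 0 < r := by linarith
  have hρ0 : 0 < ρ := lt_of_lt_of_le (by positivity) hρr
  set β := B * ρ with hβ
  have hβ0 : 0 < β := by positivity
  have hβ1 : β ≤ 1 / 10 := by rw [hβ]; linarith
  set x := r⁻¹ with hx
  have hx0 : 0 < x := by positivity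
  have hx1 : x ≤ 1 := inv_le_one_of_one_le₀ hr
  have hBx : B * x ≤ β := by
    rw [hβ]; apply mul_le_mul_of_nonneg_left _ (by linarith); rw [hx]; simpa using hρr
  set d := β * x ^ 2 with hd
  have hd0 : 0 < d := by positivity
  have hq1 : q ≤ 2 * d := by
    have : 2 * B * ρ / r ^ 2 = 2 * d := by rw [hd, hβ, hx]; field_simp
    linarith
  set Y := f ^ 2 - q + c * ω ^ 2 with hY
  have hcw : 0 ≤ c * ω ^ 2 := by positivity
  have hYq : -q ≤ Y := by rw [hY]; nlinarith [sq_nonneg f]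
  have hYa : |Y| ≤ Y + 4 * d := abs_le.2 ⟨by linarith, by linarith⟩
  have hqa : |q| ≤ Y + 4 * d := abs_le.2 ⟨by linarith, by linarith⟩
  have e1 : 2 / r * (B / r * |Y|) ≤ 2 * (β * x) * (Y + 4 * d) := by
    have : 2 / r * (B / r * |Y|) = 2 * x * (B * x) * |Y| := by rw [hx]; field_simp
    rw [this]
    calc 2 * x * (B * x) * |Y| ≤ 2 * x * β * |Y| := by gcongr
      _ ≤ 2 * x * β * (Y + 4 * d) := by gcongr
      _ = _ := by ring
  have e2 : β / r * |q| ≤ (β * x) * (Y + 4 * d) := by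
    have : β / r * |q| = β * x * |q| := by rw [hx]; ring
    rw [this]; gcongr
  have e3 : 12 * (β * x) * d ≤ 2 * (x * d) := by
    have := mul_le_mul_of_nonneg_right hβ1 (mul_pos hx0 hd0).le
    linarith [mul_pos hx0 hd0]
  have e4 : B * ρ / r ^ 3 = x * d := by rw [hx, hd, hβ, hx]; field_simp
  have e5 : 11 * B * ρ / r ^ 3 = 11 * (x * d) := by rw [hx, hd, hβ, hx]; field_simp
  have hqh : 2 * q * h ≤ 8 * (x * d) := by
    have h2 : h ≤ 2 * x := by rw [hx]; simpa [div_eq_mul_inv] using hh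
    calc 2 * q * h ≤ 2 * (2 * d) * h := by gcongr
      _ ≤ 2 * (2 * d) * (2 * x) := by gcongr
      _ = _ := by ring
  have hφφ : 2 * (h - f) * (h' - f') ≤ 2 * (h - f) * q := by
    apply mul_le_mul_of_nonneg_left hφ'; linarith
  have hYZ : ((h - f) ^ 2 - q + c * ω ^ 2) - 2 * (h * (h - f)) ≤ Y := by
    rw [hY]; nlinarith [sq_nonneg h]
  have hcoef : 0 ≤ (2 - 3 * β) * x := by apply mul_nonneg _ hx0.le; linarith
  have hmul := mul_le_mul_of_nonneg_left hYZ hcoef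
  have hlast : (2 - 3 * β) * x * (2 * (h * (h - f))) ≤ 2 * x * (2 * (h * (h - f))) := by
    apply mul_le_mul_of_nonneg_right
    · linarith [mul_pos hβ0 hx0]
    · have : 0 ≤ h - f := by linarith
      positivity
  have e6 : (2 - 3 * B * ρ) / r = (2 - 3 * β) * x := by rw [hx, hβ]; ring
  have e7 : 4 / r = 4 * x := by rw [hx]; ring
  have e8 : 2 / r * (Y - B / r * |Y|) = 2 * x * Y - 2 / r * (B / r * |Y|) := by rw [hx]; ring
  rw [e6, e7, e5]
  rw [e8, e4] at hq'
  clear_value x d Y β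
  linarith

/-- The system satisfied on `[s, T]` by the logarithmic derivative `f = F / M` and the
normalized Pohozaev flux `q = P / M`, as long as `M ≥ D r ^ 3`. Here `ρ` is `r ^ (-a)` and `γ` is
a normalized primitive of the error term. -/
structure NormalizedSystem (a B c ω s T : ℝ) (f q ρ γ f' q' γ' : ℝ → ℝ) : Prop where
  one_le_s : 1 ≤ s
  s_le_T : s ≤ T
  a_pos : 0 < a
  a_le : a ≤ 1
  one_le_B : 1 ≤ B
  c_pos : 0 < c
  ω_pos : 0 < ω
  cont_f : ContinuousOn f (Icc s T)
  cont_q : ContinuousOn q (Icc s T)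
  cont_γ : ContinuousOn γ (Icc s T)
  cont_ρ : ContinuousOn ρ (Icc s T)
  deriv_f : ∀ r ∈ Ioo s T, HasDerivAt f (f' r) r
  deriv_q : ∀ r ∈ Ioo s T, HasDerivAt q (q' r) r
  deriv_γ : ∀ r ∈ Ioo s T, HasDerivAt γ (γ' r) r
  deriv_ρ : ∀ r ∈ Ioo s T, HasDerivAt ρ (-a * ρ r / r) r
  inv_le_ρ : ∀ r ∈ Icc s T, 1 / r ≤ ρ r
  ρ_le : ∀ r ∈ Icc s T, 10 * B * ρ r ≤ a
  γ_nonneg : ∀ r ∈ Icc s T, 0 ≤ γ r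
  γ_le_one : ∀ r ∈ Icc s T, γ r ≤ 1
  γ'_nonneg : ∀ r ∈ Ioo s T, 0 ≤ γ' r
  flux : ∀ r ∈ Ioo s T, f' r ≥ -q r - B / r ^ 3 - γ' r / r ^ 3
  pohozaev : ∀ r ∈ Ioo s T, q' r ≥ 2 / r * ((f r ^ 2 - q r + c * ω ^ 2)
      - B / r * |f r ^ 2 - q r + c * ω ^ 2|) - B * ρ r / r ^ 3 - B * ρ r / r * |q r|
      - (1 + ω) * γ' r / r ^ 3 - 2 * q r * f r
  q_le : ∀ r ∈ Icc s T, q r ≤ 2 * B * ρ r / r ^ 2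
  f_end : f T ≤ 3 / (2 * T)

namespace NormalizedSystem

variable {a B c ω s T : ℝ} {f q ρ γ f' q' γ' : ℝ → ℝ}

/-- An upper barrier for `f`. -/
noncomputable def barrier (B T : ℝ) (ρ γ : ℝ → ℝ) (r : ℝ) : ℝ :=
  3 / (2 * T) + 4 * B * ρ r / r + (1 - γ r) / r ^ 3

/-- The derivative of `barrier`. -/
noncomputable def barrierDeriv (a B : ℝ) (ρ γ γ' : ℝ → ℝ) (r : ℝ) : ℝ :=
  -(4 * B * (1 + a) * ρ r / r ^ 2) - γ' r / r ^ 3 - 3 * (1 - γ r) / r ^ 4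

theorem one_le (H : NormalizedSystem a B c ω s T f q ρ γ f' q' γ') {r : ℝ}
    (hr : r ∈ Icc s T) : 1 ≤ r := H.one_le_s.trans hr.1

theorem ρ_pos (H : NormalizedSystem a B c ω s T f q ρ γ f' q' γ') {r : ℝ}
    (hr : r ∈ Icc s T) : 0 < ρ r := by
  have := H.one_le hr
  exact lt_of_lt_of_le (by positivity) (H.inv_le_ρ r hr)

theorem mono (H : NormalizedSystem a B c ω s T f q ρ γ f' q' γ') {t : ℝ} (ht : t ∈ Icc s T) :
    NormalizedSystem a B c ω t T f q ρ γ f' q' γ' := by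
  have hc : Icc t T ⊆ Icc s T := Icc_subset_Icc_left ht.1
  have ho : Ioo t T ⊆ Ioo s T := Ioo_subset_Ioo_left ht.1
  exact ⟨H.one_le ht, ht.2, H.a_pos, H.a_le, H.one_le_B, H.c_pos, H.ω_pos, H.cont_f.mono hc,
    H.cont_q.mono hc, H.cont_γ.mono hc, H.cont_ρ.mono hc, fun r hr => H.deriv_f r (ho hr),
    fun r hr => H.deriv_q r (ho hr), fun r hr => H.deriv_γ r (ho hr),
    fun r hr => H.deriv_ρ r (ho hr), fun r hr => H.inv_le_ρ r (hc hr),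
    fun r hr => H.ρ_le r (hc hr), fun r hr => H.γ_nonneg r (hc hr),
    fun r hr => H.γ_le_one r (hc hr), fun r hr => H.γ'_nonneg r (ho hr),
    fun r hr => H.flux r (ho hr), fun r hr => H.pohozaev r (ho hr),
    fun r hr => H.q_le r (hc hr), H.f_end⟩

theorem barrier_nonneg (H : NormalizedSystem a B c ω s T f q ρ γ f' q' γ') {r : ℝ}
    (hr : r ∈ Icc s T) : 0 ≤ barrier B T ρ γ r := by
  have h1 := H.one_le hr
  have hT : 0 < T := by linarith [hr.2]
  have h2 := (H.ρ_pos hr).le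
  have h3 : 0 ≤ 1 - γ r := by linarith [H.γ_le_one r hr]
  have h4 := H.one_le_B
  unfold barrier; positivity

theorem barrier_le (H : NormalizedSystem a B c ω s T f q ρ γ f' q' γ') {r : ℝ}
    (hr : r ∈ Icc s T) : barrier B T ρ γ r ≤ 3 / (2 * T) + 5 * B * ρ r / r := by
  have h1 := H.one_le hr
  have h2 := (H.ρ_pos hr).le
  have h3 := H.γ_nonneg r hr
  have h4 := H.one_le_B
  have h5 := H.inv_le_ρ r hr
  have hr0 : 0 < r := by linarith
  have : (1 - γ r) / r ^ 3 ≤ B * ρ r / r := by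
    calc (1 - γ r) / r ^ 3 ≤ 1 / r ^ 3 := by gcongr; linarith
      _ = (1 / r) * (1 / r) * (1 / r) := by field_simp
      _ ≤ 1 * (1 / r) * (1 / r) := by
          gcongr
          rw [div_le_one hr0]; exact h1
      _ ≤ B * ρ r * (1 / r) := by gcongr
      _ = _ := by ring
  unfold barrier
  have e : 5 * B * ρ r / r = 4 * B * ρ r / r + B * ρ r / r := by ring
  linarith

theorem barrier_le_two_div (H : NormalizedSystem a B c ω s T f q ρ γ f' q' γ') {r : ℝ}
    (hr : r ∈ Icc s T) : barrier B T ρ γ r ≤ 2 / r := by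
  refine (H.barrier_le hr).trans ?_
  have h1 := H.one_le hr
  have hr0 : 0 < r := by linarith
  have h2 := H.ρ_le r hr
  have h3 := H.a_le
  have h4 : 3 / (2 * T) ≤ 3 / (2 * r) := by
    have := hr.2
    gcongr
  have h5 : 5 * B * ρ r / r ≤ (1 / 2) / r := by gcongr; linarith
  have e : 2 / r = 3 / (2 * r) + (1 / 2) / r := by field_simp; norm_num
  linarith

theorem hasDerivAt_barrier (H : NormalizedSystem a B c ω s T f q ρ γ f' q' γ') {r : ℝ}
    (hr : r ∈ Ioo s T) :
    HasDerivAt (barrier B T ρ γ) (barrierDeriv a B ρ γ γ' r) r := by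
  have h1 := H.one_le (Ioo_subset_Icc_self hr)
  have hr0 : r ≠ 0 := by linarith
  have hd := ((((H.deriv_ρ r hr).const_mul (4 * B)).div (hasDerivAt_id r) hr0).const_add
    (3 / (2 * T))).add ((((H.deriv_γ r hr).const_sub 1)).div ((hasDerivAt_id r).pow 3)
      (pow_ne_zero 3 hr0))
  refine hd.congr_deriv ?_
  simp only [barrierDeriv, id, Pi.pow_apply]
  field_simp
  ring

theorem continuousOn_barrier (H : NormalizedSystem a B c ω s T f q ρ γ f' q' γ') :
    ContinuousOn (barrier B T ρ γ) (Icc s T) := by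
  have hne : ∀ r ∈ Icc s T, r ≠ 0 := fun r hr => by linarith [H.one_le hr]
  exact (continuousOn_const.add ((continuousOn_const.mul H.cont_ρ).div continuousOn_id hne)).add
    ((continuousOn_const.sub H.cont_γ).div (continuousOn_id.pow 3)
      fun r hr => pow_ne_zero 3 (hne r hr))

theorem gap_deriv_le (H : NormalizedSystem a B c ω s T f q ρ γ f' q' γ') {r : ℝ}
    (hr : r ∈ Ioo s T) :
    barrierDeriv a B ρ γ γ' r - f' r ≤ q r - 2 * B * ρ r / r ^ 2 := by
  have hr' := Ioo_subset_Icc_self hr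
  have h1 := H.one_le hr'
  have hr0 : 0 < r := by linarith
  have h2 := (H.ρ_pos hr').le
  have h3 := H.flux r hr
  have hB := H.one_le_B
  have ha := H.a_pos
  have h4 : B / r ^ 3 ≤ B * ρ r / r ^ 2 := by
    have h5 := H.inv_le_ρ r hr'
    calc B / r ^ 3 = B * (1 / r) / r ^ 2 := by field_simp
      _ ≤ _ := by gcongr
  have h6 : 0 ≤ 3 * (1 - γ r) / r ^ 4 := by
    have : 0 ≤ 1 - γ r := by linarith [H.γ_le_one r hr']
    positivity
  have h7 : 4 * B * (1 + a) * ρ r / r ^ 2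
      = 4 * (B * ρ r / r ^ 2) + 4 * (a * (B * ρ r / r ^ 2)) := by
    ring
  have h8 : 0 ≤ B * ρ r / r ^ 2 := by positivity
  have h9 : 0 ≤ a * (B * ρ r / r ^ 2) := by positivity
  have h10 : 2 * B * ρ r / r ^ 2 = 2 * (B * ρ r / r ^ 2) := by ring
  unfold barrierDeriv
  linarith

theorem gap_deriv_le_q (H : NormalizedSystem a B c ω s T f q ρ γ f' q' γ') {r : ℝ}
    (hr : r ∈ Ioo s T) : barrierDeriv a B ρ γ γ' r - f' r ≤ q r := by
  have hr' := Ioo_subset_Icc_self hr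
  have h1 := H.one_le hr'
  have h2 := (H.ρ_pos hr').le
  have hB := H.one_le_B
  have : 0 ≤ 2 * B * ρ r / r ^ 2 := by positivity
  linarith [H.gap_deriv_le hr]

theorem antitoneOn_gap (H : NormalizedSystem a B c ω s T f q ρ γ f' q' γ') :
    AntitoneOn (fun r => barrier B T ρ γ r - f r) (Icc s T) := by
  refine antitoneOn_of_hasDerivWithinAt_nonpos (convex_Icc s T)
    (f' := fun r => barrierDeriv a B ρ γ γ' r - f' r)
    (H.continuousOn_barrier.sub H.cont_f) ?_ ?_
  · intro r hr
    rw [interior_Icc] at hr ⊢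
    exact ((H.hasDerivAt_barrier hr).sub (H.deriv_f r hr)).hasDerivWithinAt
  · intro r hr
    rw [interior_Icc] at hr
    linarith [H.gap_deriv_le hr, H.q_le r (Ioo_subset_Icc_self hr)]

theorem f_le_barrier (H : NormalizedSystem a B c ω s T f q ρ γ f' q' γ') {r : ℝ}
    (hr : r ∈ Icc s T) : f r ≤ barrier B T ρ γ r := by
  have hT : T ∈ Icc s T := right_mem_Icc.2 H.s_le_T
  have h := H.antitoneOn_gap hr hT hr.2
  have hT1 := H.one_le hT
  have h2 := (H.ρ_pos hT).le
  have hB := H.one_le_B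
  have h3 : 0 ≤ 1 - γ T := by linarith [H.γ_le_one T hT]
  have h4 : 0 ≤ 4 * B * ρ T / T + (1 - γ T) / T ^ 3 := by positivity
  have h5 := H.f_end
  beta_reduce at h
  unfold barrier at h ⊢
  linarith

theorem sub_two_le (H : NormalizedSystem a B c ω s T f q ρ γ f' q' γ') {r : ℝ}
    (hr : r ∈ Icc s T) : f s - 2 ≤ f r := by
  have hs : s ∈ Icc s T := left_mem_Icc.2 H.s_le_T
  have h := H.antitoneOn_gap hs hr hr.1
  have h1 := H.barrier_nonneg hr
  have h2 := H.barrier_le_two_div hs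
  have h3 : 2 / s ≤ 2 := div_le_self (by norm_num) H.one_le_s
  beta_reduce at h
  linarith

/-- The weight `r ^ 2 * exp (3 B ρ / a)`. -/
noncomputable def weight (a B : ℝ) (ρ : ℝ → ℝ) (r : ℝ) : ℝ := r ^ 2 * Real.exp (3 * B * ρ r / a)

/-- The weighted energy controlling the gap between `f` and its barrier. -/
noncomputable def energy (a B c ω T : ℝ) (f q ρ γ : ℝ → ℝ) (r : ℝ) : ℝ :=
  weight a B ρ r * ((barrier B T ρ γ r - f r) ^ 2 - q r + c * ω ^ 2) + 2

theorem sq_le_weight (H : NormalizedSystem a B c ω s T f q ρ γ f' q' γ') {r : ℝ}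
    (hr : r ∈ Icc s T) : r ^ 2 ≤ weight a B ρ r := by
  have h1 := H.ρ_pos hr
  have hB := H.one_le_B
  have ha := H.a_pos
  have : 1 ≤ Real.exp (3 * B * ρ r / a) := Real.one_le_exp (by positivity)
  unfold weight
  nlinarith [sq_nonneg r]

theorem weight_le (H : NormalizedSystem a B c ω s T f q ρ γ f' q' γ') {r : ℝ}
    (hr : r ∈ Icc s T) : weight a B ρ r ≤ 2 * r ^ 2 := by
  have ha := H.a_pos
  have h0 : 3 * B * ρ r / a ≤ Real.log 2 := by
    have : 3 * B * ρ r / a ≤ 1 / 2 := by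
      rw [div_le_iff₀ ha]; linarith [H.ρ_le r hr]
    linarith [Real.log_two_gt_d9]
  have : Real.exp (3 * B * ρ r / a) ≤ 2 := by
    have := Real.exp_le_exp.2 h0
    rwa [Real.exp_log (by norm_num)] at this
  unfold weight
  nlinarith [sq_nonneg r]

theorem weight_mul_q_le (H : NormalizedSystem a B c ω s T f q ρ γ f' q' γ') {r : ℝ}
    (hr : r ∈ Icc s T) : weight a B ρ r * q r ≤ 1 := by
  have h1 := H.one_le hr
  have hr0 : 0 < r := by linarith
  have hw0 : 0 ≤ weight a B ρ r := (sq_nonneg r).trans (H.sq_le_weight hr)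
  have h2 := (H.ρ_pos hr).le
  have hB := H.one_le_B
  calc weight a B ρ r * q r ≤ weight a B ρ r * (2 * B * ρ r / r ^ 2) :=
        mul_le_mul_of_nonneg_left (H.q_le r hr) hw0
    _ ≤ (2 * r ^ 2) * (2 * B * ρ r / r ^ 2) := by
        apply mul_le_mul_of_nonneg_right (H.weight_le hr); positivity
    _ = 4 * B * ρ r := by field_simp; ring
    _ ≤ 1 := by
        have : 0 ≤ B * ρ r := by positivity
        linarith [H.ρ_le r hr, H.a_le]

theorem sq_add_le_energy (H : NormalizedSystem a B c ω s T f q ρ γ f' q' γ') {r : ℝ}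
    (hr : r ∈ Icc s T) :
    r ^ 2 * (barrier B T ρ γ r - f r) ^ 2 + r ^ 2 * (c * ω ^ 2) + 1
      ≤ energy a B c ω T f q ρ γ r := by
  have h1 := H.sq_le_weight hr
  have h2 := H.weight_mul_q_le hr
  have hc := H.c_pos
  have h3 : 0 ≤ (barrier B T ρ γ r - f r) ^ 2 + c * ω ^ 2 := by positivity
  have h4 := mul_le_mul_of_nonneg_right h1 h3
  unfold energy
  linarith

/-- The derivative of `energy`. -/
noncomputable def energyDeriv (a B c ω T : ℝ) (f q ρ γ f' q' γ' : ℝ → ℝ) (r : ℝ) : ℝ :=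
  weight a B ρ r * ((2 - 3 * B * ρ r) / r * ((barrier B T ρ γ r - f r) ^ 2 - q r + c * ω ^ 2)
    + (2 * (barrier B T ρ γ r - f r) * (barrierDeriv a B ρ γ γ' r - f' r) - q' r))

theorem hasDerivAt_energy (H : NormalizedSystem a B c ω s T f q ρ γ f' q' γ') {r : ℝ}
    (hr : r ∈ Ioo s T) :
    HasDerivAt (energy a B c ω T f q ρ γ) (energyDeriv a B c ω T f q ρ γ f' q' γ' r) r := by
  have h1 := H.one_le (Ioo_subset_Icc_self hr)
  have hr0 : r ≠ 0 := by linarith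
  have ha := H.a_pos.ne'
  have hw := ((hasDerivAt_id r).pow 2).mul
    ((((H.deriv_ρ r hr).const_mul (3 * B)).div_const a).exp)
  have hz := ((((H.hasDerivAt_barrier hr).sub (H.deriv_f r hr)).pow 2).sub
    (H.deriv_q r hr)).add_const (c * ω ^ 2)
  have hd := (hw.mul hz).add_const 2
  refine hd.congr_deriv ?_
  simp only [energyDeriv, weight, id, Pi.mul_apply, Pi.pow_apply, Pi.sub_apply]
  field_simp
  ring

theorem continuousOn_energy (H : NormalizedSystem a B c ω s T f q ρ γ f' q' γ') :
    ContinuousOn (energy a B c ω T f q ρ γ) (Icc s T) :=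
  (((continuousOn_id.pow 2).mul
    (((continuousOn_const.mul H.cont_ρ).div_const a).rexp)).mul
    ((((H.continuousOn_barrier.sub H.cont_f).pow 2).sub H.cont_q).add continuousOn_const)).add
    continuousOn_const

theorem energyDeriv_le (H : NormalizedSystem a B c ω s T f q ρ γ f' q' γ') {r : ℝ}
    (hr : r ∈ Ioo s T) :
    energyDeriv a B c ω T f q ρ γ f' q' γ' r ≤
      4 * (3 / (2 * T) + 5 * B * ρ r / r) * energy a B c ω T f q ρ γ r + 22 * B * ρ r / r
        + 2 * (1 + ω) * γ' r := by
  have hr' := Ioo_subset_Icc_self hr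
  have h1 := H.one_le hr'
  have hr0 : 0 < r := by linarith
  have hh0 := H.barrier_nonneg hr'
  have hfh := H.f_le_barrier hr'
  have hω := H.ω_pos
  have hB := H.one_le_B
  have hρ0 := (H.ρ_pos hr').le
  have hγ' := H.γ'_nonneg r hr
  have hpt := pohozaev_pointwise h1 H.one_le_B (H.inv_le_ρ r hr')
    ((H.ρ_le r hr').trans H.a_le) H.c_pos.le hh0 (H.barrier_le_two_div hr')
    hfh (H.q_le r hr') (H.gap_deriv_le_q hr) (H.pohozaev r hr)
  have hη := H.barrier_le hr'
  have hE := H.sq_add_le_energy hr'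
  have hcw : 0 ≤ r ^ 2 * (c * ω ^ 2) := by have := H.c_pos; positivity
  have hw0 : 0 ≤ weight a B ρ r := (sq_nonneg r).trans (H.sq_le_weight hr')
  have hw2 := H.weight_le hr'
  unfold energyDeriv
  set h := barrier B T ρ γ r
  set φ := h - f r
  have hφ : 0 ≤ φ := by simp only [φ]; linarith
  set E := energy a B c ω T f q ρ γ r
  set η := 3 / (2 * T) + 5 * B * ρ r / r
  set w := weight a B ρ r
  calc w * ((2 - 3 * B * ρ r) / r * (φ ^ 2 - q r + c * ω ^ 2)
        + (2 * φ * (barrierDeriv a B ρ γ γ' r - f' r) - q' r))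
      ≤ w * (4 / r * (h * φ) + 11 * B * ρ r / r ^ 3 + (1 + ω) * γ' r / r ^ 3) :=
        mul_le_mul_of_nonneg_left (by linarith) hw0
    _ ≤ (2 * r ^ 2) * (4 / r * (h * φ) + 11 * B * ρ r / r ^ 3 + (1 + ω) * γ' r / r ^ 3) :=
        mul_le_mul_of_nonneg_right hw2 (by positivity)
    _ = 4 * (h * (2 * (r * φ))) + 22 * B * ρ r / r + 2 * (1 + ω) * γ' r / r := by
        field_simp; ring
    _ ≤ 4 * (η * E) + 22 * B * ρ r / r + 2 * (1 + ω) * γ' r := by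
        have i1 : 2 * (r * φ) ≤ E := by nlinarith [sq_nonneg (r * φ - 1)]
        have i2 : 2 * (1 + ω) * γ' r / r ≤ 2 * (1 + ω) * γ' r :=
          div_le_self (by positivity) h1
        have i3 : h * (2 * (r * φ)) ≤ η * E :=
          mul_le_mul hη i1 (by positivity) (hh0.trans hη)
        linarith
    _ = _ := by ring

theorem energy_le (H : NormalizedSystem a B c ω s T f q ρ γ f' q' γ') {r : ℝ}
    (hr : r ∈ Icc s T) :
    energy a B c ω T f q ρ γ r ≤ Real.exp 8 * (energy a B c ω T f q ρ γ s + 3 + 2 * (1 + ω)) := by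
  have hs : s ∈ Icc s T := left_mem_Icc.2 H.s_le_T
  have ha := H.a_pos
  have hB := H.one_le_B
  have hω := H.ω_pos
  have hT : 0 < T := by linarith [H.one_le_s, H.s_le_T]
  set V := energy a B c ω T f q ρ γ with hV
  set J : ℝ → ℝ := fun r => 3 * r / (2 * T) - 5 * B * ρ r / a with hJ
  have hJlow : ∀ x ∈ Icc s T, -(1 / 2) ≤ J x := by
    intro x hx
    have i1 : 5 * B * ρ x / a ≤ 1 / 2 := by
      rw [div_le_iff₀ ha]; linarith [H.ρ_le x hx]
    have i2 : 0 ≤ 3 * x / (2 * T) := by have := H.one_le hx; positivity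
    simp only [hJ]; linarith
  have hJup : ∀ x ∈ Icc s T, J x ≤ 3 / 2 := by
    intro x hx
    have i1 : 0 ≤ 5 * B * ρ x / a := by have := (H.ρ_pos hx).le; positivity
    have i2 : 3 * x / (2 * T) ≤ 3 / 2 := by
      rw [div_le_iff₀ (by positivity)]; linarith [hx.2]
    simp only [hJ]; linarith
  have hJd : ∀ x ∈ Ioo s T, HasDerivAt J (3 / (2 * T) + 5 * B * ρ x / x) x := by
    intro x hx
    have hx0 : x ≠ 0 := by linarith [H.one_le (Ioo_subset_Icc_self hx)]
    have := (((hasDerivAt_id x).const_mul 3).div_const (2 * T)).sub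
      (((H.deriv_ρ x hx).const_mul (5 * B)).div_const a)
    refine this.congr_deriv ?_
    field_simp
    ring
  have hJc : ContinuousOn J (Icc s T) :=
    ((continuousOn_const.mul continuousOn_id).div_const _).sub
      ((continuousOn_const.mul H.cont_ρ).div_const _)
  set Q : ℝ → ℝ := fun x => V x * Real.exp (-4 * J x)
    + Real.exp 2 * (22 * B * ρ x / a - 2 * (1 + ω) * γ x) with hQ
  have hQa : AntitoneOn Q (Icc s T) := by
    refine antitoneOn_of_hasDerivWithinAt_nonpos (convex_Icc s T)
      (f' := fun x => (energyDeriv a B c ω T f q ρ γ f' q' γ' x * Real.exp (-4 * J x)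
        + V x * (Real.exp (-4 * J x) * (-4 * (3 / (2 * T) + 5 * B * ρ x / x))))
        + Real.exp 2 * (22 * B * (-a * ρ x / x) / a - 2 * (1 + ω) * γ' x)) ?_ ?_ ?_
    · exact (H.continuousOn_energy.mul (continuousOn_const.mul hJc).rexp).add
        (continuousOn_const.mul (((continuousOn_const.mul H.cont_ρ).div_const _).sub
          (continuousOn_const.mul H.cont_γ)))
    · intro x hx
      rw [interior_Icc] at hx ⊢
      exact (((H.hasDerivAt_energy hx).mul ((hJd x hx).const_mul (-4)).exp).add
        (((((H.deriv_ρ x hx).const_mul (22 * B)).div_const a).sub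
          ((H.deriv_γ x hx).const_mul (2 * (1 + ω)))).const_mul (Real.exp 2))).hasDerivWithinAt
    · intro x hx
      rw [interior_Icc] at hx
      have hx' := Ioo_subset_Icc_self hx
      have hx0 : 0 < x := by linarith [H.one_le hx']
      have hd := H.energyDeriv_le hx
      have i0 : 0 ≤ 22 * B * ρ x / x + 2 * (1 + ω) * γ' x := by
        have := (H.ρ_pos hx').le
        have := H.γ'_nonneg x hx
        positivity
      have i1 : Real.exp (-4 * J x) ≤ Real.exp 2 := Real.exp_le_exp.2 (by linarith [hJlow x hx'])
      have i2 := Real.exp_pos (-4 * J x)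
      have i3 := mul_le_mul_of_nonneg_right hd i2.le
      have i4 := mul_le_mul_of_nonneg_right i1 i0
      have i5 : 22 * B * (-a * ρ x / x) / a = -(22 * B * ρ x / x) := by field_simp
      rw [i5]
      simp only [← hV] at i3
      linarith
  have hle := hQa hs hr hr.1
  simp only [hQ] at hle
  have hVr : 0 ≤ V r := by
    have := H.sq_add_le_energy hr
    have hc := H.c_pos
    have : 0 ≤ r ^ 2 * (barrier B T ρ γ r - f r) ^ 2 + r ^ 2 * (c * ω ^ 2) + 1 := by positivity
    linarith
  have hVs : 0 ≤ V s := by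
    have := H.sq_add_le_energy hs
    have hc := H.c_pos
    have : 0 ≤ s ^ 2 * (barrier B T ρ γ s - f s) ^ 2 + s ^ 2 * (c * ω ^ 2) + 1 := by positivity
    linarith
  have j1 : V s * Real.exp (-4 * J s) ≤ V s * Real.exp 2 :=
    mul_le_mul_of_nonneg_left (Real.exp_le_exp.2 (by linarith [hJlow s hs])) hVs
  have j2 : V r * Real.exp (-6) ≤ V r * Real.exp (-4 * J r) :=
    mul_le_mul_of_nonneg_left (Real.exp_le_exp.2 (by linarith [hJup r hr])) hVr
  have j3 : 22 * B * ρ s / a ≤ 3 := by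
    rw [div_le_iff₀ ha]; linarith [H.ρ_le s hs]
  have j4 : 0 ≤ 22 * B * ρ r / a := by have := (H.ρ_pos hr).le; positivity
  have j5 : (1 + ω) * γ r ≤ 1 + ω := by
    have := H.γ_le_one r hr; nlinarith
  have j6 : 0 ≤ (1 + ω) * γ s := by
    have := H.γ_nonneg s hs; positivity
  have k : 22 * B * ρ s / a - 2 * (1 + ω) * γ s - (22 * B * ρ r / a - 2 * (1 + ω) * γ r)
      ≤ 3 + 2 * (1 + ω) := by linarith
  have k2 := mul_le_mul_of_nonneg_left k (Real.exp_pos 2).le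
  have main : V r * Real.exp (-6) ≤ Real.exp 2 * (V s + 3 + 2 * (1 + ω)) := by linarith
  have := mul_le_mul_of_nonneg_right main (Real.exp_pos 6).le
  have e1 : V r * Real.exp (-6) * Real.exp 6 = V r := by
    rw [mul_assoc, ← Real.exp_add]; simp
  have e2 : Real.exp 8 = Real.exp 2 * Real.exp 6 := by rw [← Real.exp_add]; norm_num
  rw [e1] at this
  rw [e2]
  linarith

set_option maxHeartbeats 800000 in
/-- Bounds on the length of the interval and on the decay of `f`, in terms of the initial
value of `f` only. -/
theorem exists_bound {B c κ S : ℝ} (hc : 0 < c) (hκ : 0 ≤ κ) (hS : 1 ≤ S) :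
    ∃ A : ℝ, 1 ≤ A ∧ ∀ {a ω s T : ℝ} {f q ρ γ f' q' γ' : ℝ → ℝ},
      NormalizedSystem a B c ω s T f q ρ γ f' q' γ' → s ≤ S → -(κ * (1 + ω)) ≤ f s →
      T ≤ A * (1 + ω) / ω ∧ ∀ r ∈ Icc s T, -(A * (1 + ω) / r) ≤ f r := by
  set k := κ + 2 with hk
  set A₀ := Real.exp 8 * (7 + 8 * S ^ 2 * (k ^ 2 + k + c)) with hA₀
  have hk2 : 2 ≤ k := by linarith
  have hA₀pos : 0 < A₀ := by positivity
  have hA₀c : 0 < A₀ / c := by positivity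
  have hSk : 2 * S ≤ 2 * S * k := le_mul_of_one_le_right (by linarith) (by linarith)
  refine ⟨1 + A₀ / c + A₀ + 2 * S * k, by linarith, ?_⟩
  intro a ω s T f q ρ γ f' q' γ' H hsS hfs
  set A := 1 + A₀ / c + A₀ + 2 * S * k with hA
  have hω := H.ω_pos
  have hs1 := H.one_le_s
  have hs0 : 0 < s := by linarith
  have hs : s ∈ Icc s T := left_mem_Icc.2 H.s_le_T
  have hA1 : 1 ≤ A := by linarith
  have hA0 : 0 < A := by linarith
  set φ : ℝ → ℝ := fun r => barrier B T ρ γ r - f r with hφ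
  have hφ0 : ∀ r ∈ Icc s T, 0 ≤ φ r := fun r hr => by
    have := H.f_le_barrier hr
    simp only [hφ]; linarith
  have hφs : φ s ≤ k * (1 + ω) := by
    have h2 := H.barrier_le_two_div hs
    have h3 : 2 / s ≤ 2 := div_le_self (by norm_num) hs1
    simp only [hφ]
    nlinarith
  have hφr : ∀ r ∈ Icc s T, φ r ≤ k * (1 + ω) := fun r hr =>
    (H.antitoneOn_gap hs hr hr.1).trans hφs
  have hfφ : ∀ r ∈ Icc s T, φ r * r ≤ A * (1 + ω) → -(A * (1 + ω) / r) ≤ f r := by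
    intro r hr h
    have hr0 : 0 < r := by linarith [H.one_le hr]
    have h1 := (le_div_iff₀ hr0).2 h
    have h2 := H.barrier_nonneg hr
    simp only [hφ] at h1
    linarith
  have hshort : ∀ r ∈ Icc s T, r ≤ 2 * s → -(A * (1 + ω) / r) ≤ f r := by
    intro r hr hr2
    apply hfφ r hr
    have hr0 : 0 < r := by linarith [H.one_le hr]
    calc φ r * r ≤ k * (1 + ω) * (2 * S) :=
          mul_le_mul (hφr r hr) (by linarith) hr0.le (by positivity)
      _ = 2 * S * k * (1 + ω) := by ring
      _ ≤ A * (1 + ω) := by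
          apply mul_le_mul_of_nonneg_right _ (by positivity)
          linarith
  have hone : 1 ≤ (1 + ω) / ω := by rw [le_div_iff₀ hω]; linarith
  rcases lt_or_ge T (2 * s) with hT2 | hT2
  · refine ⟨?_, fun r hr => hshort r hr (by linarith [hr.2])⟩
    calc T ≤ A * 1 := by linarith
      _ ≤ A * ((1 + ω) / ω) := by gcongr
      _ = _ := by ring
  -- a point of `[s, 2 s]` where `-q` is controlled
  have h2s : 2 * s ∈ Icc s T := ⟨by linarith, hT2⟩
  obtain ⟨t, ht, hslope⟩ := exists_hasDerivAt_eq_slope φ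
    (fun r => barrierDeriv a B ρ γ γ' r - f' r) (show s < 2 * s by linarith)
    ((H.continuousOn_barrier.sub H.cont_f).mono (Icc_subset_Icc_right hT2))
    (fun r hr => by
      have hr' : r ∈ Ioo s T := ⟨hr.1, hr.2.trans_le hT2⟩
      exact (H.hasDerivAt_barrier hr').sub (H.deriv_f r hr'))
  have htI : t ∈ Ioo s T := ⟨ht.1, ht.2.trans_le hT2⟩
  have ht' := Ioo_subset_Icc_self htI
  have hqt : -q t ≤ k * (1 + ω) := by
    have h1 := H.gap_deriv_le_q htI
    have h2 : φ (2 * s) - φ s ≥ -(k * (1 + ω)) := by linarith [hφ0 _ h2s]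
    have h3 : (φ (2 * s) - φ s) / (2 * s - s) ≥ -(k * (1 + ω)) := by
      have : 2 * s - s = s := by ring
      rw [this, ge_iff_le, le_div_iff₀ hs0]
      have : 0 ≤ k * (1 + ω) := by positivity
      nlinarith
    linarith
  have H' := H.mono ht'
  have hEt : energy a B c ω T f q ρ γ t ≤ (2 + 8 * S ^ 2 * (k ^ 2 + k + c)) * (1 + ω) ^ 2 := by
    have hw := H.weight_le ht'
    have hw0 : 0 ≤ weight a B ρ t := (sq_nonneg t).trans (H.sq_le_weight ht')
    have hw' : weight a B ρ t ≤ 8 * S ^ 2 := by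
      have : t ≤ 2 * S := by linarith [ht.2]
      have h0 : t ^ 2 ≤ (2 * S) ^ 2 := pow_le_pow_left₀ (by linarith [ht.1]) this 2
      linarith
    have h1 : φ t ^ 2 ≤ (k * (1 + ω)) ^ 2 := pow_le_pow_left₀ (hφ0 t ht') (hφr t ht') 2
    have h2 : φ t ^ 2 - q t + c * ω ^ 2 ≤ (k ^ 2 + k + c) * (1 + ω) ^ 2 := by
      have i1 : k * (1 + ω) ≤ k * (1 + ω) ^ 2 := by
        apply mul_le_mul_of_nonneg_left _ (by linarith); nlinarith
      have i2 : c * ω ^ 2 ≤ c * (1 + ω) ^ 2 := by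
        apply mul_le_mul_of_nonneg_left _ hc.le; nlinarith
      linarith
    have h3 : weight a B ρ t * (φ t ^ 2 - q t + c * ω ^ 2)
        ≤ 8 * S ^ 2 * ((k ^ 2 + k + c) * (1 + ω) ^ 2) :=
      (mul_le_mul_of_nonneg_left h2 hw0).trans
        (mul_le_mul_of_nonneg_right hw' (by positivity))
    have h4 : (2 : ℝ) ≤ 2 * (1 + ω) ^ 2 := by nlinarith
    simp only [hφ] at h3
    unfold energy
    linarith
  have hE : ∀ r ∈ Icc t T, energy a B c ω T f q ρ γ r ≤ A₀ * (1 + ω) ^ 2 := by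
    intro r hr
    refine (H'.energy_le hr).trans ?_
    rw [hA₀, mul_assoc]
    apply mul_le_mul_of_nonneg_left _ (Real.exp_pos 8).le
    have : 3 + 2 * (1 + ω) ≤ 5 * (1 + ω) ^ 2 := by nlinarith
    linarith
  refine ⟨?_, fun r hr => ?_⟩
  · have hTT : T ∈ Icc t T := right_mem_Icc.2 ht'.2
    have h1 := H'.sq_add_le_energy hTT
    have h2 := hE T hTT
    have hT0 : 0 < T := by linarith
    have h3 : T ^ 2 * (c * ω ^ 2) ≤ A₀ * (1 + ω) ^ 2 := by
      have : 0 ≤ T ^ 2 * (barrier B T ρ γ T - f T) ^ 2 := by positivity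
      linarith
    rw [le_div_iff₀ hω]
    rw [← pow_le_pow_iff_left₀ (by positivity) (by positivity) two_ne_zero]
    have h4 : (T * ω) ^ 2 ≤ A₀ / c * (1 + ω) ^ 2 := by
      have : A₀ / c * (1 + ω) ^ 2 = A₀ * (1 + ω) ^ 2 / c := by ring
      rw [this, le_div_iff₀ hc]
      linarith
    have h5 : A₀ / c ≤ A ^ 2 := by
      have : A₀ / c ≤ A := by linarith
      nlinarith
    calc (T * ω) ^ 2 ≤ A₀ / c * (1 + ω) ^ 2 := h4
      _ ≤ A ^ 2 * (1 + ω) ^ 2 := by gcongr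
      _ = _ := by ring
  · rcases le_or_gt r t with hrt | hrt
    · exact hshort r hr (by linarith [ht.2])
    have hr' : r ∈ Icc t T := ⟨hrt.le, hr.2⟩
    have hr0 : 0 < r := by linarith [H.one_le hr]
    apply hfφ r hr
    have h1 := H'.sq_add_le_energy hr'
    have h2 := hE r hr'
    have h0 := hφ0 r hr
    rw [← pow_le_pow_iff_left₀ (by positivity) (by positivity) two_ne_zero]
    have h3 : (φ r * r) ^ 2 ≤ A₀ * (1 + ω) ^ 2 := by
      have : 0 ≤ r ^ 2 * (c * ω ^ 2) := by positivity
      simp only [hφ]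
      linarith
    have h5 : A₀ ≤ A ^ 2 := by
      have : A₀ ≤ A := by linarith
      nlinarith
    calc (φ r * r) ^ 2 ≤ A₀ * (1 + ω) ^ 2 := h3
      _ ≤ A ^ 2 * (1 + ω) ^ 2 := by gcongr
      _ = _ := by ring

end NormalizedSystem

/-- The system of differential inequalities for the mass `M`, flux `F` and Pohozaev flux `P`
on `[s₀, ∞)`, where the error terms are dominated by the derivative of a function
`γ` with values in `[0, 1]`. -/
structure EnergySystem (a B c ω D s₀ : ℝ) (M F P F' P' γ γ' : ℝ → ℝ) : Prop where
  a_pos : 0 < a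
  a_le : a ≤ 1
  one_le_B : 1 ≤ B
  c_pos : 0 < c
  ω_pos : 0 < ω
  D_pos : 0 < D
  one_le_s₀ : 1 ≤ s₀
  s₀_large : 10 * B * s₀ ^ (-a) ≤ a
  M_pos : ∀ r ∈ Ici s₀, 0 < M r
  deriv_M : ∀ r ∈ Ici s₀, HasDerivWithinAt M (2 * F r) (Ici s₀) r
  deriv_F : ∀ r ∈ Ici s₀, HasDerivWithinAt F (F' r) (Ici s₀) r
  deriv_P : ∀ r ∈ Ici s₀, HasDerivWithinAt P (P' r) (Ici s₀) r
  deriv_γ : ∀ r, HasDerivAt γ (γ' r) r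
  γ_nonneg : ∀ r ∈ Ici s₀, 0 ≤ γ r
  γ_le_one : ∀ r ∈ Ici s₀, γ r ≤ 1
  γ'_nonneg : ∀ r ∈ Ici s₀, 0 ≤ γ' r
  flux : ∀ r ∈ Ici s₀,
    F' r ≥ 2 * (F r) ^ 2 / M r - P r - B * r ^ (-(3 : ℝ)) * M r - D * γ' r
  pohozaev : ∀ r ∈ Ici s₀,
    P' r ≥ 2 / r * (((F r) ^ 2 / M r - P r + c * ω ^ 2 * M r)
        - B / r * |(F r) ^ 2 / M r - P r + c * ω ^ 2 * M r|)
      - B * r ^ (-3 - a) * M r - B * r ^ (-1 - a) * |P r| - (1 + ω) * (D * γ' r)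
  P_le : ∀ r ∈ Ici s₀, P r ≤ B * (D + r ^ (-2 - a) * M r)
  tendsto : Tendsto (fun r => (1 / r) * ∫ s in r..(2 * r), (M s + |F s| + |P s|)) atTop (nhds 0)

namespace EnergySystem

variable {a B c ω D s₀ : ℝ} {M F P F' P' γ γ' : ℝ → ℝ}

theorem continuousOn_M (H : EnergySystem a B c ω D s₀ M F P F' P' γ γ') :
    ContinuousOn M (Ici s₀) := fun r hr => (H.deriv_M r hr).continuousWithinAt

theorem continuousOn_F (H : EnergySystem a B c ω D s₀ M F P F' P' γ γ') :
    ContinuousOn F (Ici s₀) := fun r hr => (H.deriv_F r hr).continuousWithinAt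

theorem continuousOn_P (H : EnergySystem a B c ω D s₀ M F P F' P' γ γ') :
    ContinuousOn P (Ici s₀) := fun r hr => (H.deriv_P r hr).continuousWithinAt

theorem pos_of_mem (H : EnergySystem a B c ω D s₀ M F P F' P' γ γ') {r : ℝ} (hr : r ∈ Ici s₀) :
    0 < r := lt_of_lt_of_le (by linarith [H.one_le_s₀]) (mem_Ici.1 hr)

theorem hasDerivAt_M (H : EnergySystem a B c ω D s₀ M F P F' P' γ γ') {r : ℝ} (hr : s₀ < r) :
    HasDerivAt M (2 * F r) r := (H.deriv_M r hr.le).hasDerivAt (Ici_mem_nhds hr)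

theorem normalized (H : EnergySystem a B c ω D s₀ M F P F' P' γ γ') {s T : ℝ} (hs : s₀ ≤ s)
    (hsT : s ≤ T) (hM : ∀ r ∈ Icc s T, D * r ^ 3 ≤ M r) (hT : F T / M T ≤ 3 / (2 * T)) :
    NormalizedSystem a B c ω s T (fun r => F r / M r) (fun r => P r / M r) (fun r => r ^ (-a)) γ
      (fun r => F' r / M r - 2 * (F r) ^ 2 / (M r) ^ 2)
      (fun r => P' r / M r - 2 * P r * F r / (M r) ^ 2) γ' := by
  have hsub : Icc s T ⊆ Ici s₀ := fun r hr => hs.trans hr.1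
  have hsubo : Ioo s T ⊆ Ici s₀ := fun r hr => hs.trans hr.1.le
  have hne : ∀ r ∈ Icc s T, M r ≠ 0 := fun r hr => (H.M_pos r (hsub hr)).ne'
  have hD := H.D_pos
  have hB := H.one_le_B
  have hω := H.ω_pos
  have hinv : ∀ r ∈ Icc s T, 1 / r ≤ r ^ (-a) := by
    intro r hr
    have : 1 / r = r ^ (-1 : ℝ) := by rw [Real.rpow_neg_one, one_div]
    rw [this]
    exact Real.rpow_le_rpow_of_exponent_le (H.one_le_s₀.trans (hsub hr)) (by linarith [H.a_le])
  have hpow : ∀ r : ℝ, 0 < r → ∀ n : ℕ, r ^ (-(n : ℝ) - a) = r ^ (-a) / r ^ n := by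
    intro r hr n
    rw [show -(n : ℝ) - a = -a - n by ring, Real.rpow_sub hr, Real.rpow_natCast]
  have hp1 : ∀ r : ℝ, 0 < r → r ^ (-1 - a) = r ^ (-a) / r := by
    intro r hr; simpa using hpow r hr 1
  have hp2 : ∀ r : ℝ, 0 < r → r ^ (-2 - a) = r ^ (-a) / r ^ 2 := by
    intro r hr; simpa using hpow r hr 2
  have hp3 : ∀ r : ℝ, 0 < r → r ^ (-3 - a) = r ^ (-a) / r ^ 3 := by
    intro r hr; simpa using hpow r hr 3
  have hDM : ∀ r ∈ Icc s T, D / M r ≤ 1 / r ^ 3 := by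
    intro r hr
    have hr0 := H.pos_of_mem (hsub hr)
    rw [div_le_div_iff₀ (H.M_pos r (hsub hr)) (by positivity)]
    linarith [hM r hr]
  refine ⟨H.one_le_s₀.trans hs, hsT, H.a_pos, H.a_le, hB, H.c_pos, hω,
    (H.continuousOn_F.mono hsub).div (H.continuousOn_M.mono hsub) hne,
    (H.continuousOn_P.mono hsub).div (H.continuousOn_M.mono hsub) hne,
    fun r _ => (H.deriv_γ r).continuousAt.continuousWithinAt, ?_, ?_, ?_,
    fun r _ => H.deriv_γ r, ?_, hinv, ?_, fun r hr => H.γ_nonneg r (hsub hr),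
    fun r hr => H.γ_le_one r (hsub hr), fun r hr => H.γ'_nonneg r (hsubo hr), ?_, ?_, ?_, hT⟩
  · intro r hr
    exact (Real.continuousAt_rpow_const _ _
      (Or.inl (H.pos_of_mem (hsub hr)).ne')).continuousWithinAt
  · intro r hr
    have hr0 : s₀ < r := hs.trans_lt hr.1
    have hM0 := hne r (Ioo_subset_Icc_self hr)
    refine (((H.deriv_F r hr0.le).hasDerivAt (Ici_mem_nhds hr0)).div
      (H.hasDerivAt_M hr0) hM0).congr_deriv ?_
    field_simp
  · intro r hr
    have hr0 : s₀ < r := hs.trans_lt hr.1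
    have hM0 := hne r (Ioo_subset_Icc_self hr)
    refine (((H.deriv_P r hr0.le).hasDerivAt (Ici_mem_nhds hr0)).div
      (H.hasDerivAt_M hr0) hM0).congr_deriv ?_
    field_simp
  · intro r hr
    have hr0 := H.pos_of_mem (hsubo hr)
    refine (Real.hasDerivAt_rpow_const (p := -a) (Or.inl hr0.ne')).congr_deriv ?_
    rw [Real.rpow_sub hr0, Real.rpow_one]
    ring
  · intro r hr
    have hs0 : 0 < s₀ := by linarith [H.one_le_s₀]
    have : r ^ (-a) ≤ s₀ ^ (-a) :=
      Real.rpow_le_rpow_of_nonpos hs0 (hsub hr) (by linarith [H.a_pos])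
    have := mul_le_mul_of_nonneg_left this (by linarith : 0 ≤ 10 * B)
    exact this.trans H.s₀_large
  · intro r hr
    have hr' := Ioo_subset_Icc_self hr
    have hr0 := H.pos_of_mem (hsubo hr)
    have hM0 := H.M_pos r (hsubo hr)
    have h := div_le_div_of_nonneg_right (H.flux r (hsubo hr)) hM0.le
    have e : r ^ (-(3 : ℝ)) = 1 / r ^ 3 := by
      rw [Real.rpow_neg hr0.le, one_div]; norm_cast
    rw [e] at h
    have e2 : (2 * F r ^ 2 / M r - P r - B * (1 / r ^ 3) * M r - D * γ' r) / M r
        = 2 * F r ^ 2 / M r ^ 2 - P r / M r - B / r ^ 3 - D / M r * γ' r := by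
      field_simp
    rw [e2] at h
    have h2 := mul_le_mul_of_nonneg_right (hDM r hr') (H.γ'_nonneg r (hsubo hr))
    have e3 : 1 / r ^ 3 * γ' r = γ' r / r ^ 3 := by ring
    rw [e3] at h2
    linarith
  · intro r hr
    have hr' := Ioo_subset_Icc_self hr
    have hr0 := H.pos_of_mem (hsubo hr)
    have hM0 := H.M_pos r (hsubo hr)
    have h := div_le_div_of_nonneg_right (H.pohozaev r (hsubo hr)) hM0.le
    rw [hp1 r hr0, hp3 r hr0] at h
    have eY : (F r) ^ 2 / M r - P r + c * ω ^ 2 * M r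
        = M r * ((F r / M r) ^ 2 - P r / M r + c * ω ^ 2) := by
      field_simp
    have eP : |P r| = M r * |P r / M r| := by
      rw [abs_div, abs_of_pos hM0]; field_simp
    rw [eY, abs_mul, abs_of_pos hM0, eP] at h
    set Y := (F r / M r) ^ 2 - P r / M r + c * ω ^ 2
    set y := |Y|
    set p := |P r / M r|
    have e2 : (2 / r * (M r * Y - B / r * (M r * y)) - B * (r ^ (-a) / r ^ 3) * M r
          - B * (r ^ (-a) / r) * (M r * p) - (1 + ω) * (D * γ' r)) / M r
        = 2 / r * (Y - B / r * y) - B * r ^ (-a) / r ^ 3 - B * r ^ (-a) / r * p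
          - (D / M r) * ((1 + ω) * γ' r) := by
      field_simp
    rw [e2] at h
    have h2 := mul_le_mul_of_nonneg_right (hDM r hr')
      (mul_nonneg (by linarith : 0 ≤ 1 + ω) (H.γ'_nonneg r (hsubo hr)))
    have e3 : 1 / r ^ 3 * ((1 + ω) * γ' r) = (1 + ω) * γ' r / r ^ 3 := by ring
    rw [e3] at h2
    have e4 : 2 * (P r / M r) * (F r / M r) = 2 * P r * F r / M r ^ 2 := by
      field_simp
    rw [e4]
    linarith
  · intro r hr
    have hr0 := H.pos_of_mem (hsub hr)
    have hM0 := H.M_pos r (hsub hr)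
    have h := div_le_div_of_nonneg_right (H.P_le r (hsub hr)) hM0.le
    rw [hp2 r hr0] at h
    have e2 : B * (D + r ^ (-a) / r ^ 2 * M r) / M r
        = B * (D / M r) + B * (r ^ (-a) / r ^ 2) := by
      field_simp
    rw [e2] at h
    have h2 : D / M r ≤ r ^ (-a) / r ^ 2 := by
      refine (hDM r hr).trans ?_
      calc 1 / r ^ 3 = (1 / r) / r ^ 2 := by field_simp
        _ ≤ _ := by have := hinv r hr; gcongr
    have h3 := mul_le_mul_of_nonneg_left h2 (by linarith : 0 ≤ B)
    have e4 : 2 * B * r ^ (-a) / r ^ 2 = 2 * (B * (r ^ (-a) / r ^ 2)) := by ring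
    rw [e4]
    linarith

theorem exists_mass_le (H : EnergySystem a B c ω D s₀ M F P F' P' γ γ') (s : ℝ) (hs : s₀ ≤ s) :
    ∃ r, s ≤ r ∧ M r ≤ D * r ^ 3 := by
  by_contra! hcon
  have hD := H.D_pos
  obtain ⟨r, hr, hrs⟩ := ((H.tendsto.eventually (gt_mem_nhds hD)).and (eventually_ge_atTop s)).exists
  have hrs₀ : s₀ ≤ r := hs.trans hrs
  have hr1 : 1 ≤ r := H.one_le_s₀.trans hrs₀
  have hr0 : 0 < r := by linarith
  have hsub : Icc r (2 * r) ⊆ Ici s₀ := fun x hx => hrs₀.trans hx.1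
  have hle : r ≤ 2 * r := by linarith
  have hint : ∫ _ in r..(2 * r), D ≤ ∫ x in r..(2 * r), (M x + |F x| + |P x|) := by
    apply intervalIntegral.integral_mono_on hle intervalIntegrable_const
    · apply ContinuousOn.intervalIntegrable
      rw [uIcc_of_le hle]
      exact ((H.continuousOn_M.add H.continuousOn_F.abs).add H.continuousOn_P.abs).mono hsub
    · intro x hx
      have h1 := hcon x (hrs.trans hx.1)
      have h2 : 1 ≤ x ^ 3 := one_le_pow₀ (hr1.trans hx.1)
      have h3 : D ≤ D * x ^ 3 := le_mul_of_one_le_right hD.le h2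
      linarith [abs_nonneg (F x), abs_nonneg (P x)]
  rw [intervalIntegral.integral_const, smul_eq_mul] at hint
  have h4 := mul_le_mul_of_nonneg_left hint (by positivity : 0 ≤ 1 / r)
  have h5 : 1 / r * ((2 * r - r) * D) = D := by field_simp; ring
  linarith

theorem exists_threshold (H : EnergySystem a B c ω D s₀ M F P F' P' γ γ') {s : ℝ} (hs : s₀ ≤ s)
    (hMs : D * s ^ 3 < M s) :
    ∃ T, s < T ∧ M T = D * T ^ 3 ∧ (∀ r ∈ Icc s T, D * r ^ 3 ≤ M r) ∧
      F T / M T ≤ 3 / (2 * T) := by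
  obtain ⟨r₁, hr₁, hMr₁⟩ := H.exists_mass_le s hs
  set g : ℝ → ℝ := fun r => M r - D * r ^ 3 with hg
  have hgc : ContinuousOn g (Icc s r₁) :=
    (H.continuousOn_M.mono fun x hx => hs.trans hx.1).sub (by fun_prop)
  have hK : IsCompact (Icc s r₁ ∩ g ⁻¹' Iic 0) :=
    isCompact_Icc.of_isClosed_subset (hgc.preimage_isClosed_of_isClosed isClosed_Icc isClosed_Iic)
      inter_subset_left
  obtain ⟨T, ⟨hTI, hgT⟩, hleast⟩ := hK.exists_isLeast
    ⟨r₁, right_mem_Icc.2 hr₁, by simp only [hg, mem_preimage, mem_Iic]; linarith⟩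
  have hgT' : g T ≤ 0 := hgT
  have hgs : 0 < g s := by simp only [hg]; linarith
  have hsT : s < T := lt_of_le_of_ne hTI.1 (by rintro rfl; linarith)
  have hpos : ∀ r ∈ Ico s T, 0 < g r := by
    intro r hr
    by_contra! hcon
    exact absurd (hleast ⟨⟨hr.1, hr.2.le.trans hTI.2⟩, hcon⟩) (not_le.2 hr.2)
  have hgT0 : g T = 0 := by
    obtain ⟨r, hr, hr0⟩ := intermediate_value_Icc' hsT.le (hgc.mono (Icc_subset_Icc_right hTI.2))
      ⟨hgT', hgs.le⟩
    rcases hr.2.lt_or_eq with h | h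
    · exact absurd hr0 (hpos r ⟨hr.1, h⟩).ne'
    · rwa [h] at hr0
  have hMT : M T = D * T ^ 3 := by simp only [hg] at hgT0; linarith
  have hT0 : 0 < T := H.pos_of_mem (hs.trans hsT.le)
  refine ⟨T, hsT, hMT, fun r hr => ?_, ?_⟩
  · rcases hr.2.lt_or_eq with h | h
    · have := hpos r ⟨hr.1, h⟩
      simp only [hg] at this
      linarith
    · rw [h, hMT]
  · have hd : HasDerivAt g (2 * F T - D * (3 * T ^ 2)) T :=
      ((H.hasDerivAt_M (hs.trans_lt hsT)).sub ((hasDerivAt_pow 3 T).const_mul D)).congr_deriv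
        (by norm_num)
    have hslope := (hasDerivWithinAt_iff_tendsto_slope' self_notMem_Iio).1
      (hd.hasDerivWithinAt (s := Iio T))
    have hle : 2 * F T - D * (3 * T ^ 2) ≤ 0 := by
      refine le_of_tendsto hslope ?_
      filter_upwards [Ioo_mem_nhdsLT hsT] with r hr
      rw [slope_def_field, hgT0]
      exact div_nonpos_of_nonneg_of_nonpos (by linarith [hpos r ⟨hr.1.le, hr.2⟩])
        (by linarith [hr.2])
    have hD := H.D_pos
    rw [hMT, div_le_div_iff₀ (by positivity) (by positivity)]
    nlinarith

theorem mass_le_exp (H : EnergySystem a B c ω D s₀ M F P F' P' γ γ') {s T k : ℝ} (hs : s₀ ≤ s)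
    (hsT : s ≤ T) (hF : ∀ r ∈ Icc s T, -k ≤ F r / M r) :
    M s ≤ M T * Real.exp (2 * k * (T - s)) := by
  have hsub : Icc s T ⊆ Ici s₀ := fun r hr => hs.trans hr.1
  have hmono : MonotoneOn (fun r => M r * Real.exp (2 * k * r)) (Icc s T) := by
    refine monotoneOn_of_hasDerivWithinAt_nonneg (convex_Icc s T)
      (f' := fun r => 2 * F r * Real.exp (2 * k * r)
        + M r * (Real.exp (2 * k * r) * (2 * k * 1))) ?_ ?_ ?_
    · exact (H.continuousOn_M.mono hsub).mul (by fun_prop)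
    · intro r hr
      rw [interior_Icc] at hr ⊢
      exact ((H.hasDerivAt_M (hs.trans_lt hr.1)).mul
        ((hasDerivAt_id r).const_mul (2 * k)).exp).hasDerivWithinAt
    · intro r hr
      rw [interior_Icc] at hr
      have hr' := Ioo_subset_Icc_self hr
      have h1 := (le_div_iff₀ (H.M_pos r (hsub hr'))).1 (hF r hr')
      have h2 := Real.exp_pos (2 * k * r)
      have h3 : 0 ≤ (F r + k * M r) * Real.exp (2 * k * r) := mul_nonneg (by linarith) h2.le
      linarith
  have h := hmono (left_mem_Icc.2 hsT) (right_mem_Icc.2 hsT) hsT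
  beta_reduce at h
  have h' := mul_le_mul_of_nonneg_right h (Real.exp_pos (-(2 * k * s))).le
  have e1 : Real.exp (2 * k * s) * Real.exp (-(2 * k * s)) = 1 := by
    rw [← Real.exp_add, add_neg_cancel, Real.exp_zero]
  have e2 : Real.exp (2 * k * T) * Real.exp (-(2 * k * s)) = Real.exp (2 * k * (T - s)) := by
    rw [← Real.exp_add]
    congr 1
    ring
  rw [mul_assoc (M s), e1, mul_one, mul_assoc (M T), e2] at h'
  exact h'

theorem mass_le_rpow (H : EnergySystem a B c ω D s₀ M F P F' P' γ γ') {s T N : ℝ} (hs : s₀ ≤ s)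
    (hsT : s ≤ T) (hN : 0 ≤ N) (hF : ∀ r ∈ Icc s T, -(N / r) ≤ F r / M r) :
    M s ≤ M T * T ^ (2 * N) := by
  have hsub : Icc s T ⊆ Ici s₀ := fun r hr => hs.trans hr.1
  have hmono : MonotoneOn (fun r => M r * r ^ (2 * N)) (Icc s T) := by
    refine monotoneOn_of_hasDerivWithinAt_nonneg (convex_Icc s T)
      (f' := fun r => 2 * F r * r ^ (2 * N) + M r * (2 * N * r ^ (2 * N - 1))) ?_ ?_ ?_
    · exact (H.continuousOn_M.mono hsub).mul
        fun r hr => (Real.continuousAt_rpow_const _ _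
          (Or.inl (H.pos_of_mem (hsub hr)).ne')).continuousWithinAt
    · intro r hr
      rw [interior_Icc] at hr ⊢
      exact ((H.hasDerivAt_M (hs.trans_lt hr.1)).mul (Real.hasDerivAt_rpow_const
        (Or.inl (H.pos_of_mem (hsub (Ioo_subset_Icc_self hr))).ne'))).hasDerivWithinAt
    · intro r hr
      rw [interior_Icc] at hr
      have hr' := Ioo_subset_Icc_self hr
      have hr0 := H.pos_of_mem (hsub hr')
      have h1 := (le_div_iff₀ (H.M_pos r (hsub hr'))).1 (hF r hr')
      have h2 : 0 ≤ r ^ (2 * N) := by positivity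
      have h3 : 0 ≤ (F r + N / r * M r) * r ^ (2 * N) := mul_nonneg (by linarith) h2
      rw [Real.rpow_sub hr0, Real.rpow_one]
      have e : 2 * F r * r ^ (2 * N) + M r * (2 * N * (r ^ (2 * N) / r))
          = 2 * ((F r + N / r * M r) * r ^ (2 * N)) := by ring
      rw [e]
      linarith
  have h := hmono (left_mem_Icc.2 hsT) (right_mem_Icc.2 hsT) hsT
  refine le_trans ?_ h
  exact le_mul_of_one_le_right (H.M_pos s hs).le
    (Real.one_le_rpow (H.one_le_s₀.trans hs) (by linarith))

set_option maxHeartbeats 800000 in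
/-- If the logarithmic derivative of the mass is not too negative at a controlled location, the
mass is bounded there (at low frequency) or at a later controlled location (at high frequency). -/
theorem exists_mass_bound {B c κ S : ℝ} (hc : 0 < c) (hκ : 0 ≤ κ) (hS : 1 ≤ S) :
    ∃ K : ℝ, 1 ≤ K ∧ ∀ {a ω D s₀ : ℝ} {M F P F' P' γ γ' : ℝ → ℝ},
      EnergySystem a B c ω D s₀ M F P F' P' γ γ' → ∀ s, s₀ ≤ s → s ≤ S →
      -(κ * (1 + ω)) ≤ F s / M s →
      (ω ≤ 1 → M s ≤ K * ω ^ (-K) * D) ∧ (1 ≤ ω → ∃ T ∈ Icc s K, M T ≤ K * D) ∧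
      (1 ≤ ω → 0 ≤ F s → M s ≤ K * D) := by
  obtain ⟨A, hA1, hA⟩ := NormalizedSystem.exists_bound hc hκ hS
  have hA0 : 0 < A := by linarith
  set N := 3 + 4 * A with hN
  have hp1 : 0 < (2 * A) ^ N := by positivity
  have hp2 : 0 < (2 * A) ^ 3 * Real.exp (8 * A) := by positivity
  have hp3 : (2 * A) ^ 3 ≤ (2 * A) ^ 3 * Real.exp (8 * A) :=
    le_mul_of_one_le_right (by positivity) (Real.one_le_exp (by positivity))
  have hS3 : S ≤ S ^ 3 := le_self_pow₀ hS (by norm_num)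
  refine ⟨(2 * A) ^ N + N + (2 * A) ^ 3 * Real.exp (8 * A) + S ^ 3, by linarith, ?_⟩
  set K := (2 * A) ^ N + N + (2 * A) ^ 3 * Real.exp (8 * A) + S ^ 3 with hK
  intro a ω D s₀ M F P F' P' γ γ' H s hs hsS hfs
  have hω := H.ω_pos
  have hD := H.D_pos
  have hs1 : 1 ≤ s := H.one_le_s₀.trans hs
  have hK0 : 0 < K := by linarith
  rcases le_or_gt (M s) (D * s ^ 3) with hlow | hhigh
  · have h1 : M s ≤ K * D := by
      have h2 : s ^ 3 ≤ S ^ 3 := pow_le_pow_left₀ (by linarith) hsS 3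
      have h3 : s ^ 3 ≤ K := by linarith
      calc M s ≤ D * s ^ 3 := hlow
        _ ≤ D * K := by gcongr
        _ = _ := by ring
    refine ⟨fun h => h1.trans ?_, fun _ => ⟨s, ⟨le_rfl, by linarith⟩, h1⟩, fun _ _ => h1⟩
    have : 1 ≤ ω ^ (-K) := Real.one_le_rpow_of_pos_of_le_one_of_nonpos hω h (by linarith)
    have : K ≤ K * ω ^ (-K) := le_mul_of_one_le_right hK0.le this
    gcongr
  obtain ⟨T, hsT, hMT, hMr, hFT⟩ := H.exists_threshold hs hhigh
  have HN := H.normalized hs hsT.le hMr hFT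
  obtain ⟨hTA, hlb⟩ := hA HN hsS hfs
  have hT1 : 1 ≤ T := by linarith
  have hT0 : 0 < T := by linarith
  have hT2 : 1 ≤ ω → T ≤ 2 * A := by
    intro h
    refine hTA.trans ?_
    rw [div_le_iff₀ hω]
    nlinarith
  refine ⟨fun h => ?_, fun h => ⟨T, ⟨hsT.le, ?_⟩, ?_⟩, fun h hF => ?_⟩
  · have h1 : T ≤ 2 * A / ω := hTA.trans (div_le_div_of_nonneg_right (by nlinarith) hω.le)
    have h2 := H.mass_le_rpow hs hsT.le (N := A * (1 + ω)) (by positivity) hlb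
    have h3 : T ^ (2 * (A * (1 + ω))) ≤ T ^ (4 * A) :=
      Real.rpow_le_rpow_of_exponent_le hT1 (by nlinarith)
    have h4 : T ^ N = T ^ 3 * T ^ (4 * A) := by
      rw [hN, Real.rpow_add hT0]; norm_cast
    calc M s ≤ D * T ^ 3 * T ^ (2 * (A * (1 + ω))) := by rw [← hMT]; exact h2
      _ ≤ D * T ^ 3 * T ^ (4 * A) := by gcongr
      _ = D * T ^ N := by rw [h4]; ring
      _ ≤ D * (2 * A / ω) ^ N := by gcongr
      _ = (2 * A) ^ N * ω ^ (-N) * D := by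
          rw [Real.div_rpow (by positivity) hω.le, Real.rpow_neg hω.le]; ring
      _ ≤ K * ω ^ (-K) * D := by
          have h5 : ω ^ (-N) ≤ ω ^ (-K) :=
            Real.rpow_le_rpow_of_exponent_ge hω h (by linarith)
          have h6 : (2 * A) ^ N ≤ K := by linarith
          gcongr
  · linarith [hT2 h]
  · rw [hMT]
    have h2 : T ^ 3 ≤ (2 * A) ^ 3 := pow_le_pow_left₀ hT0.le (hT2 h) 3
    have h3 : T ^ 3 ≤ K := by linarith
    calc D * T ^ 3 ≤ D * K := by gcongr
      _ = _ := by ring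
  · have h1 : ∀ r ∈ Icc s T, -2 ≤ F r / M r := by
      intro r hr
      have h2 := HN.sub_two_le hr
      have h3 : 0 ≤ F s / M s := div_nonneg hF (H.M_pos s hs).le
      linarith
    have h2 := H.mass_le_exp hs hsT.le h1
    have h3 : Real.exp (2 * 2 * (T - s)) ≤ Real.exp (8 * A) :=
      Real.exp_le_exp.2 (by linarith [hT2 h])
    have h4 : T ^ 3 ≤ (2 * A) ^ 3 := pow_le_pow_left₀ hT0.le (hT2 h) 3
    calc M s ≤ D * T ^ 3 * Real.exp (2 * 2 * (T - s)) := by rw [← hMT]; exact h2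
      _ ≤ D * (2 * A) ^ 3 * Real.exp (8 * A) := by gcongr
      _ = (2 * A) ^ 3 * Real.exp (8 * A) * D := by ring
      _ ≤ K * D := by
          have : (2 * A) ^ 3 * Real.exp (8 * A) ≤ K := by linarith [pow_pos (by linarith : 0 < S) 3]
          gcongr

end EnergySystem

/-- The error term `G` in the hypotheses can be replaced by a continuous one, which has a
differentiable primitive. -/
theorem exists_energySystem {a B c ω D s₀ : ℝ} {M F P M' F' P' G ε : ℝ → ℝ}
    (ha : 0 < a) (ha' : a ≤ 1) (hB : 1 ≤ B) (hc : 0 < c) (hω : 0 < ω) (hD : 0 < D)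
    (hs₀ : 1 ≤ s₀) (hs₀' : 10 * B * s₀ ^ (-a) ≤ a)
    (hM : ∀ r ∈ Ici s₀, 0 < M r)
    (hM' : ∀ r ∈ Ici s₀, HasDerivWithinAt M (M' r) (Ici s₀) r)
    (hF' : ∀ r ∈ Ici s₀, HasDerivWithinAt F (F' r) (Ici s₀) r) (hF'c : ContinuousOn F' (Ici s₀))
    (hP' : ∀ r ∈ Ici s₀, HasDerivWithinAt P (P' r) (Ici s₀) r) (hP'c : ContinuousOn P' (Ici s₀))
    (hG : ∀ r ∈ Ici s₀, 0 ≤ G r) (hGi : IntegrableOn G (Ici s₀)) (hGD : ∫ r in Ici s₀, G r ≤ D)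
    (hMF : ∀ r ∈ Ici s₀, M' r = 2 * F r)
    (hflux : ∀ r ∈ Ici s₀,
      F' r ≥ 2 * (F r) ^ 2 / M r - P r - B * r ^ (-(3 : ℝ)) * M r - G r)
    (hε : ∀ r ∈ Ici s₀, |ε r| ≤ B / r)
    (hpoh : ∀ r ∈ Ici s₀,
      P' r ≥ (2 / r) * (1 + ε r) * ((F r) ^ 2 / M r - P r + c * ω ^ 2 * M r)
        - B * r ^ (-3 - a) * M r - B * r ^ (-1 - a) * |P r| - (1 + ω) * G r)
    (hP : ∀ r ∈ Ici s₀, P r ≤ B * (D + r ^ (-2 - a) * M r))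
    (hlim : Tendsto (fun r => (1 / r) * ∫ s in r..(2 * r), (M s + |F s| + |P s|)) atTop (nhds 0)) :
    ∃ γ γ' : ℝ → ℝ, EnergySystem a B c ω D s₀ M F P F' P' γ γ' := by
  have hpos : ∀ r ∈ Ici s₀, (0 : ℝ) < r := fun r hr => by linarith [mem_Ici.1 hr]
  have hMc : ContinuousOn M (Ici s₀) := fun r hr => (hM' r hr).continuousWithinAt
  have hFc : ContinuousOn F (Ici s₀) := fun r hr => (hF' r hr).continuousWithinAt
  have hPc : ContinuousOn P (Ici s₀) := fun r hr => (hP' r hr).continuousWithinAt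
  have hM0 : ∀ r ∈ Ici s₀, M r ≠ 0 := fun r hr => (hM r hr).ne'
  have hr0 : ∀ r ∈ Ici s₀, r ≠ 0 := fun r hr => (hpos r hr).ne'
  have hpow : ∀ p : ℝ, ContinuousOn (fun r : ℝ => r ^ p) (Ici s₀) := fun p =>
    continuousOn_id.rpow_const fun r hr => Or.inl (hr0 r hr)
  have hdiv : ∀ k : ℝ, ContinuousOn (fun r : ℝ => k / r) (Ici s₀) := fun k =>
    continuousOn_const.div continuousOn_id hr0
  set Y : ℝ → ℝ := fun r => (F r) ^ 2 / M r - P r + c * ω ^ 2 * M r with hY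
  have hYc : ContinuousOn Y (Ici s₀) :=
    (((hFc.pow 2).div hMc hM0).sub hPc).add (continuousOn_const.mul hMc)
  set u : ℝ → ℝ := fun r => 2 * (F r) ^ 2 / M r - P r - B * r ^ (-(3 : ℝ)) * M r - F' r with hu
  set v : ℝ → ℝ := fun r => (2 / r * (Y r - B / r * |Y r|) - B * r ^ (-3 - a) * M r
    - B * r ^ (-1 - a) * |P r| - P' r) / (1 + ω) with hv
  have huc : ContinuousOn u (Ici s₀) :=
    ((((continuousOn_const.mul (hFc.pow 2)).div hMc hM0).sub hPc).sub
      ((continuousOn_const.mul (hpow _)).mul hMc)).sub hF'c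
  have hvc : ContinuousOn v (Ici s₀) :=
    (((((hdiv 2).mul (hYc.sub ((hdiv B).mul hYc.abs))).sub
      ((continuousOn_const.mul (hpow _)).mul hMc)).sub
      ((continuousOn_const.mul (hpow _)).mul hPc.abs)).sub hP'c).div_const _
  set g₀ : ℝ → ℝ := fun r => max 0 (max (u r) (v r)) with hg₀
  have hg₀c : ContinuousOn g₀ (Ici s₀) := continuousOn_const.sup (huc.sup hvc)
  have hg₀G : ∀ r ∈ Ici s₀, g₀ r ≤ G r := by
    intro r hr
    refine max_le (hG r hr) (max_le ?_ ?_)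
    · simp only [hu]
      linarith [hflux r hr]
    · simp only [hv]
      rw [div_le_iff₀ (by positivity)]
      have h1 := hpoh r hr
      have h2 : -(B / r * |Y r|) ≤ ε r * Y r := by
        have h3 : |ε r * Y r| ≤ B / r * |Y r| := by
          rw [abs_mul]
          exact mul_le_mul_of_nonneg_right (hε r hr) (abs_nonneg _)
        linarith [neg_abs_le (ε r * Y r)]
      have h4 : 2 / r * (Y r - B / r * |Y r|) ≤ 2 / r * ((1 + ε r) * Y r) :=
        mul_le_mul_of_nonneg_left (by linarith) (div_nonneg zero_le_two (hpos r hr).le)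
      rw [← mul_assoc] at h4
      simp only [hY] at h4 ⊢
      linarith
  set g : ℝ → ℝ := fun x => g₀ (max s₀ x) with hg
  have hgc : Continuous g := by
    exact hg₀c.comp_continuous (continuous_const.max continuous_id)
      fun x => mem_Ici.2 (le_max_left _ _)
  have hgeq : ∀ r ∈ Ici s₀, g r = g₀ r := fun r hr => by simp only [hg, max_eq_right (mem_Ici.1 hr)]
  have hg0 : ∀ r, 0 ≤ g r := fun r => le_max_left _ _
  have hgint : ∀ r ∈ Ici s₀, ∫ x in s₀..r, g x ≤ D := by
    intro r hr
    rw [intervalIntegral.integral_of_le hr]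
    have hsub : Ioc s₀ r ⊆ Ici s₀ := fun x hx => hx.1.le
    calc ∫ x in Ioc s₀ r, g x ≤ ∫ x in Ioc s₀ r, G x := by
          refine setIntegral_mono_on (hgc.integrableOn_Ioc) (hGi.mono_set hsub)
            measurableSet_Ioc fun x hx => ?_
          rw [hgeq x (hsub hx)]
          exact hg₀G x (hsub hx)
      _ ≤ ∫ x in Ici s₀, G x := by
          refine setIntegral_mono_set hGi ?_ (Eventually.of_forall hsub)
          exact (ae_restrict_mem measurableSet_Ici).mono hG
      _ ≤ D := hGD
  have hDg : ∀ r ∈ Ici s₀, D * (g r / D) = g₀ r := fun r hr => by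
    rw [mul_div_cancel₀ _ hD.ne', hgeq r hr]
  refine ⟨fun r => (∫ x in s₀..r, g x) / D, fun r => g r / D, ha, ha', hB, hc, hω, hD, hs₀, hs₀',
    hM, fun r hr => hMF r hr ▸ hM' r hr, hF', hP',
    fun r => (hgc.integral_hasStrictDerivAt s₀ r).hasDerivAt.div_const D, ?_, ?_, ?_, ?_, ?_,
    hP, hlim⟩
  · intro r hr
    exact div_nonneg (intervalIntegral.integral_nonneg hr fun x _ => hg0 x) hD.le
  · intro r hr
    exact (div_le_one hD).2 (hgint r hr)
  · intro r _
    exact div_nonneg (hg0 r) hD.le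
  · intro r hr
    rw [hDg r hr]
    have h : u r ≤ g₀ r := (le_max_left _ _).trans (le_max_right _ _)
    simp only [hu] at h
    linarith
  · intro r hr
    rw [hDg r hr]
    have h : v r ≤ g₀ r := (le_max_right _ _).trans (le_max_right _ _)
    simp only [hv] at h
    rw [div_le_iff₀ (by positivity)] at h
    linarith

/-- A differentiable function that is at most `b` at the left end of an interval remains so if it
is at most `b` wherever its derivative is positive. -/
theorem le_of_le_of_deriv_pos_imp_le {f f' : ℝ → ℝ} {x y b : ℝ} (hxy : x ≤ y)
    (hfc : ContinuousOn f (Icc x y)) (hf : ∀ t ∈ Ioo x y, HasDerivAt f (f' t) t)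
    (hx : f x ≤ b) (h : ∀ t ∈ Ioo x y, 0 < f' t → f t ≤ b) : f y ≤ b := by
  by_contra! hy
  have hK : IsCompact (Icc x y ∩ f ⁻¹' Iic b) :=
    isCompact_Icc.of_isClosed_subset (hfc.preimage_isClosed_of_isClosed isClosed_Icc isClosed_Iic)
      inter_subset_left
  obtain ⟨t, ⟨htI, htb⟩, hgreatest⟩ := hK.exists_isGreatest ⟨x, left_mem_Icc.2 hxy, hx⟩
  have htb' : f t ≤ b := htb
  have hty : t < y := lt_of_le_of_ne htI.2 (by rintro rfl; linarith)
  obtain ⟨z, hz, hfz⟩ := exists_hasDerivAt_eq_slope f f' hty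
    (hfc.mono (Icc_subset_Icc_left htI.1)) fun w hw => hf w ⟨htI.1.trans_lt hw.1, hw.2⟩
  have hz' : z ∈ Ioo x y := ⟨htI.1.trans_lt hz.1, hz.2⟩
  have hpos : 0 < f' z := hfz ▸ div_pos (by linarith) (by linarith)
  exact absurd (hgreatest ⟨Ioo_subset_Icc_self hz', h z hz' hpos⟩) (not_le.2 hz.1)

/-- The Rodnianski–Tao ODE dichotomy for the system of differential inequalities satisfied
by the spherical energies `M` (mass), `F` (flux) and `P` (Pohozaev flux) of a
frequency-localized solution: either the mass is bounded by the data `D` on a dyadic region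
at a controlled location, or it grows exponentially inward near `r = C₁`. -/
theorem rodnianski_tao_ode_dichotomy
    (a B c : ℝ) (ha : 0 < a) (ha' : a ≤ 1) (hB : 1 ≤ B) (hc : 0 < c) :
    ∃ C₁0 : ℝ, 1 ≤ C₁0 ∧ ∀ C₁ : ℝ, C₁0 ≤ C₁ →
    ∃ C₂0 : ℝ, 1 ≤ C₂0 ∧ ∀ C₂ : ℝ, C₂0 ≤ C₂ →
    ∃ C₃ : ℝ, 1 ≤ C₃ ∧
    ∀ (ω D : ℝ), 0 < ω → 0 < D →
    ∀ (M F P M' F' P' G : ℝ → ℝ),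
      (∀ r ∈ Ici C₁, 0 < M r) →
      (∀ r ∈ Ici C₁, HasDerivWithinAt M (M' r) (Ici C₁) r) → ContinuousOn M' (Ici C₁) →
      (∀ r ∈ Ici C₁, HasDerivWithinAt F (F' r) (Ici C₁) r) → ContinuousOn F' (Ici C₁) →
      (∀ r ∈ Ici C₁, HasDerivWithinAt P (P' r) (Ici C₁) r) → ContinuousOn P' (Ici C₁) →
      (∀ r ∈ Ici C₁, 0 ≤ G r) → IntegrableOn G (Ici C₁) →
      (∫ r in Ici C₁, G r) ≤ D →
      -- (i) M' = 2F
      (∀ r ∈ Ici C₁, M' r = 2 * F r) →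
      -- (ii) F' ≥ 2F²/M − P − B r⁻³ M − G
      (∀ r ∈ Ici C₁,
        F' r ≥ 2 * (F r) ^ 2 / M r - P r - B * r ^ (-(3 : ℝ)) * M r - G r) →
      -- (iii) P' ≥ (2/r)(1+ε)(F²/M − P + c ω² M) − B r^{−3−a} M − B r^{−1−a} |P| − (1+ω) G
      (∃ ε : ℝ → ℝ, (∀ r ∈ Ici C₁, |ε r| ≤ B / r) ∧
        ∀ r ∈ Ici C₁,
          P' r ≥ (2 / r) * (1 + ε r) * ((F r) ^ 2 / M r - P r + c * ω ^ 2 * M r)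
            - B * r ^ (-3 - a) * M r - B * r ^ (-1 - a) * |P r| - (1 + ω) * G r) →
      -- (iv) P ≤ B (D + r^{−2−a} M)
      (∀ r ∈ Ici C₁, P r ≤ B * (D + r ^ (-2 - a) * M r)) →
      -- (v) vanishing averaged data at infinity
      Tendsto (fun r => (1 / r) * ∫ s in r..(2 * r), (M s + |F s| + |P s|)) atTop (nhds 0) →
      -- conclusion: boundedness, or exponential growth from infinity
      ((∃ R₀ : ℝ, C₁ < R₀ ∧ R₀ < C₃ ∧
          ∀ r ∈ Icc (R₀ / 2) (4 * R₀), M r ≤ C₃ * (ω ^ (-(2 * C₃)) + 1) * D)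
        ∨ (∀ r ∈ Icc C₁ (10 * C₁), M' r ≤ -C₂ * (1 + ω) * M r)) := by
  obtain ⟨C₁0, hC₁0, hC₁0'⟩ : ∃ C : ℝ, 1 ≤ C ∧ 10 * B * C ^ (-a) ≤ a := by
    refine ⟨(10 * B / a) ^ (1 / a), Real.one_le_rpow ?_ (by positivity), ?_⟩
    · rw [le_div_iff₀ ha]
      linarith
    · have hX : 0 < 10 * B / a := by positivity
      rw [← Real.rpow_mul hX.le, show 1 / a * -a = -1 by field_simp, Real.rpow_neg_one]
      field_simp
      exact le_refl _
  refine ⟨C₁0, hC₁0, fun C₁ hC₁ => ⟨1, le_rfl, fun C₂ hC₂ => ?_⟩⟩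
  have hC₁1 : 1 ≤ C₁ := hC₁0.trans hC₁
  have hC₁' : 10 * B * C₁ ^ (-a) ≤ a := by
    refine le_trans ?_ hC₁0'
    have := Real.rpow_le_rpow_of_nonpos (by linarith : 0 < C₁0) hC₁ (by linarith : -a ≤ 0)
    gcongr
  obtain ⟨K, hK1, hK⟩ := EnergySystem.exists_mass_bound (B := B) (c := c) (κ := C₂)
    (S := 10 * C₁) hc (by linarith) (by linarith)
  obtain ⟨L, hL1, hL⟩ := EnergySystem.exists_mass_bound (B := B) (c := c) (κ := 0)
    (S := 8 * (K + 10 * C₁)) hc le_rfl (by linarith)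
  set C₃ := K + L + 2 * (K + 10 * C₁) + 1 with hC₃
  refine ⟨C₃, by linarith, ?_⟩
  intro ω D hω hD M F P M' F' P' G hM hM' _ hF' hF'c hP' hP'c hG hGi hGD hMF hflux ⟨ε, hε, hpoh⟩
    hP hlim
  obtain ⟨γ, γ', H⟩ := exists_energySystem ha ha' hB hc hω hD hC₁1 hC₁' hM hM' hF' hF'c hP' hP'c
    hG hGi hGD hMF hflux hε hpoh hP hlim
  refine or_iff_not_imp_right.2 fun hexp => ?_
  push Not at hexp
  obtain ⟨s, hs, hMs⟩ := hexp
  have hFs : -(C₂ * (1 + ω)) ≤ F s / M s := by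
    rw [le_div_iff₀ (hM s hs.1)]
    rw [hMF s hs.1] at hMs
    have : 0 ≤ C₂ * (1 + ω) * M s := by
      have := hM s hs.1
      positivity
    linarith
  have hlow : ∀ {k}, 1 ≤ k → k ≤ C₃ → ω ≤ 1 →
      k * ω ^ (-k) * D ≤ C₃ * (ω ^ (-(2 * C₃)) + 1) * D := by
    intro k hk hkC h
    have h1 : ω ^ (-k) ≤ ω ^ (-(2 * C₃)) :=
      Real.rpow_le_rpow_of_exponent_ge hω h (by linarith)
    have h2 : ω ^ (-k) ≤ ω ^ (-(2 * C₃)) + 1 := by linarith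
    have h3 : 0 ≤ C₃ := by linarith
    gcongr
  have hhigh : ∀ {k}, 1 ≤ k → k ≤ C₃ → k * D ≤ C₃ * (ω ^ (-(2 * C₃)) + 1) * D := by
    intro k hk hkC
    have h1 : 1 ≤ ω ^ (-(2 * C₃)) + 1 := by linarith [Real.rpow_pos_of_pos hω (-(2 * C₃))]
    have h3 : 0 ≤ C₃ := by linarith
    have h2 : k ≤ C₃ * (ω ^ (-(2 * C₃)) + 1) := hkC.trans (le_mul_of_one_le_right h3 h1)
    gcongr
  obtain ⟨hK₁, hK₂, -⟩ := hK H s hs.1 hs.2 hFs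
  obtain ⟨T, hsT, hTK, hMT⟩ : ∃ T, s ≤ T ∧ T ≤ K + 10 * C₁ ∧
      M T ≤ C₃ * (ω ^ (-(2 * C₃)) + 1) * D := by
    rcases le_total ω 1 with h | h
    · exact ⟨s, le_rfl, by linarith [hs.2], (hK₁ h).trans (hlow hK1 (by linarith) h)⟩
    · obtain ⟨T, hT, hMT⟩ := hK₂ h
      exact ⟨T, hT.1, by linarith [hT.2], hMT.trans (hhigh hK1 (by linarith))⟩
  have hC₁T : C₁ ≤ T := hs.1.trans hsT
  refine ⟨2 * T, by linarith, by linarith, fun r hr => ?_⟩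
  have hTr : T ≤ r := by linarith [hr.1]
  refine le_of_le_of_deriv_pos_imp_le (f' := fun t => 2 * F t) hTr
    (H.continuousOn_M.mono fun t ht => hC₁T.trans ht.1)
    (fun t ht => H.hasDerivAt_M (hC₁T.trans_lt ht.1)) hMT fun t ht hFt => ?_
  have hC₁t : C₁ ≤ t := hC₁T.trans ht.1.le
  have hFt' : 0 ≤ F t := by linarith
  obtain ⟨hL₁, -, hL₃⟩ := hL H t hC₁t (by linarith [ht.2, hr.2])
    (by simpa using div_nonneg hFt' (hM t hC₁t).le)
  rcases le_total ω 1 with h | h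
  · exact (hL₁ h).trans (hlow hL1 (by linarith) h)
  · exact (hL₃ h hFt').trans (hhigh hL1 (by linarith))
end

section
/- For every natural number l, the function f_l : (0,π) → ℝ defined by f_l(φ) = (sin φ)^l · cos φ satisfies the exact identity ∫_0^π (f_l'(φ))²·(sin φ)² dφ = (3(l+1)²/(2l+1))·∫_0^π (f_l(φ))²·(sin φ)² dφ. -/
open MeasureTheory

/-- The radial profile `f_l(φ) = sin^l φ · cos φ` of the quasimodes on the round 3-sphere. -/
noncomputable def quasimodeProfile (l : ℕ) : ℝ → ℝ := fun φ => Real.sin φ ^ l * Real.cos φ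

theorem deriv_quasimodeProfile_mul_sin (l : ℕ) (φ : ℝ) :
    deriv (quasimodeProfile l) φ * Real.sin φ =
      l * Real.sin φ ^ l - (l + 1) * Real.sin φ ^ (l + 2) := by
  have h : HasDerivAt (quasimodeProfile l)
      (l * Real.sin φ ^ (l - 1) * Real.cos φ * Real.cos φ +
        Real.sin φ ^ l * -Real.sin φ) φ :=
    ((Real.hasDerivAt_sin φ).pow l).mul (Real.hasDerivAt_cos φ)
  rw [h.deriv]
  cases l with
  | zero => simp; ring
  | succ k =>
    simp only [Nat.add_sub_cancel]
    push_cast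
    linear_combination (k + 1) * Real.sin φ ^ (k + 1) * Real.sin_sq_add_cos_sq φ

theorem integral_sin_pow_add_two_zero_pi (n : ℕ) :
    ∫ φ in (0 : ℝ)..Real.pi, Real.sin φ ^ (n + 2) =
      (n + 1) / (n + 2) * ∫ φ in (0 : ℝ)..Real.pi, Real.sin φ ^ n := by
  simp [integral_sin_pow]

theorem intervalIntegrable_const_mul_sin_pow (c : ℝ) (n : ℕ) (a b : ℝ) :
    IntervalIntegrable (fun φ => c * Real.sin φ ^ n) volume a b :=
  (by fun_prop : Continuous fun φ => c * Real.sin φ ^ n).intervalIntegrable a b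

theorem integral_deriv_quasimodeProfile_sq (l : ℕ) :
    ∫ φ in (0 : ℝ)..Real.pi, deriv (quasimodeProfile l) φ ^ 2 * Real.sin φ ^ 2 =
      (l : ℝ) ^ 2 * (∫ φ in (0 : ℝ)..Real.pi, Real.sin φ ^ (2 * l)) -
        2 * l * (l + 1) * (∫ φ in (0 : ℝ)..Real.pi, Real.sin φ ^ (2 * l + 2)) +
        (l + 1) ^ 2 * ∫ φ in (0 : ℝ)..Real.pi, Real.sin φ ^ (2 * l + 2 + 2) := by
  have hi := intervalIntegrable_const_mul_sin_pow
  simp only [← intervalIntegral.integral_const_mul]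
  rw [← intervalIntegral.integral_sub (hi _ _ _ _) (hi _ _ _ _),
    ← intervalIntegral.integral_add ((hi _ _ _ _).sub (hi _ _ _ _)) (hi _ _ _ _)]
  refine intervalIntegral.integral_congr fun φ _ => ?_
  simp only [← mul_pow, deriv_quasimodeProfile_mul_sin]
  ring

theorem integral_quasimodeProfile_sq (l : ℕ) :
    ∫ φ in (0 : ℝ)..Real.pi, quasimodeProfile l φ ^ 2 * Real.sin φ ^ 2 =
      (∫ φ in (0 : ℝ)..Real.pi, Real.sin φ ^ (2 * l + 2)) -
        ∫ φ in (0 : ℝ)..Real.pi, Real.sin φ ^ (2 * l + 2 + 2) := by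
  have hi (n : ℕ) : IntervalIntegrable (fun φ => Real.sin φ ^ n) volume 0 Real.pi := by
    simpa using intervalIntegrable_const_mul_sin_pow 1 n 0 Real.pi
  rw [← intervalIntegral.integral_sub (hi _) (hi _)]
  refine intervalIntegral.integral_congr fun φ _ => ?_
  simp only [quasimodeProfile, mul_pow, Real.cos_sq']
  ring

/-- Exact identity for the radial Dirichlet energy of the quasimode profile:
`∫_0^π f_l'(φ)² sin²φ dφ = (3(l+1)²/(2l+1)) ∫_0^π f_l(φ)² sin²φ dφ`. -/
theorem quasimodeProfile_dirichlet_identity (l : ℕ) :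
    (∫ φ in (0:ℝ)..Real.pi, (deriv (quasimodeProfile l) φ) ^ 2 * Real.sin φ ^ 2)
      = (3 * ((l : ℝ) + 1) ^ 2 / (2 * (l : ℝ) + 1)) *
          ∫ φ in (0:ℝ)..Real.pi, (quasimodeProfile l φ) ^ 2 * Real.sin φ ^ 2 := by
  rw [integral_deriv_quasimodeProfile_sq, integral_quasimodeProfile_sq,
    integral_sin_pow_add_two_zero_pi (2 * l + 2), integral_sin_pow_add_two_zero_pi (2 * l)]
  push_cast
  have h₁ : (2 * (l : ℝ) + 1) ≠ 0 := by positivity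
  have h₂ : (2 * (l : ℝ) + 2) ≠ 0 := by positivity
  have h₃ : (2 * (l : ℝ) + 2 + 2) ≠ 0 := by positivity
  field_simp
  ring
end

section
/- There exist constants c, C > 0 such that for every integer l ≥ 1, the function f_l : (0,π) → ℝ defined by f_l(φ) = (sin φ)^l · cos φ satisfies c·l^{1/2} ≤ ∫_0^π [ (f_l'(φ))² + l(l+1)·(sin φ)^{−2}·(f_l(φ))² ]·(sin φ)² dφ ≤ C·l^{1/2}. -/
open MeasureTheory

theorem integral_sin_pow_two_mul_succ (n : ℕ) :
    (∫ x in (0:ℝ)..Real.pi, Real.sin x ^ (2 * (n + 1))) =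
      (2 * (n : ℝ) + 1) / (2 * n + 2) * ∫ x in (0:ℝ)..Real.pi, Real.sin x ^ (2 * n) := by
  rw [mul_add, mul_one, integral_sin_pow]
  simp

theorem integral_sin_pow_two_mul_sq_mul_le (n : ℕ) :
    (∫ x in (0:ℝ)..Real.pi, Real.sin x ^ (2 * n)) ^ 2 * (2 * (n : ℝ) + 1) ≤ Real.pi ^ 2 := by
  induction n with
  | zero => simp
  | succ k ih =>
    refine le_trans ?_ ih
    rw [integral_sin_pow_two_mul_succ, mul_pow, mul_right_comm, mul_comm _ (2 * (k : ℝ) + 1)]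
    refine mul_le_mul_of_nonneg_right ?_ (sq_nonneg _)
    push_cast
    rw [div_pow, div_mul_eq_mul_div, div_le_iff₀ (by positivity)]
    have hk : (0 : ℝ) ≤ k := k.cast_nonneg
    nlinarith

theorem le_integral_sin_pow_two_mul_sq_mul {n : ℕ} (hn : 1 ≤ n) :
    (Real.pi / 2) ^ 2 ≤ (∫ x in (0:ℝ)..Real.pi, Real.sin x ^ (2 * n)) ^ 2 * (n : ℝ) := by
  induction n, hn using Nat.le_induction with
  | base =>
    have h := integral_sin_pow_two_mul_succ 0
    norm_num at h
    norm_num [h, div_eq_inv_mul]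
  | succ k hk ih =>
    refine le_trans ih ?_
    rw [integral_sin_pow_two_mul_succ, mul_pow, mul_right_comm, mul_comm _ (k : ℝ)]
    refine mul_le_mul_of_nonneg_right ?_ (sq_nonneg _)
    push_cast
    rw [div_pow, div_mul_eq_mul_div, le_div_iff₀ (by positivity)]
    have hk0 : (0 : ℝ) ≤ k := k.cast_nonneg
    nlinarith

theorem hasDerivAt_quasimodeProfile (l : ℕ) (φ : ℝ) :
    HasDerivAt (quasimodeProfile l)
      (l * Real.sin φ ^ (l - 1) * Real.cos φ ^ 2 - Real.sin φ ^ (l + 1)) φ := by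
  have h := ((Real.hasDerivAt_sin φ).pow l).mul (Real.hasDerivAt_cos φ)
  refine h.congr_deriv ?_
  simp only [Pi.pow_apply]
  ring

theorem quasimodeProfile_energy_density {l : ℕ} (hl : 1 ≤ l) (φ : ℝ) :
    ((deriv (quasimodeProfile l) φ) ^ 2
        + (l : ℝ) * ((l : ℝ) + 1) * ((Real.sin φ) ^ 2)⁻¹ * (quasimodeProfile l φ) ^ 2)
        * Real.sin φ ^ 2 =
      (l : ℝ) * (2 * l + 1) * Real.sin φ ^ (2 * l)
        - 3 * l * (l + 1) * Real.sin φ ^ (2 * (l + 1))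
        + ((l : ℝ) + 1) ^ 2 * Real.sin φ ^ (2 * (l + 1 + 1)) := by
  rw [(hasDerivAt_quasimodeProfile l φ).deriv, quasimodeProfile, mul_pow _ (Real.cos φ),
    Real.cos_sq']
  obtain ⟨k, rfl⟩ := Nat.exists_eq_add_of_le' hl
  rcases eq_or_ne (Real.sin φ) 0 with h | h
  · simp [h]
  · rw [Nat.add_sub_cancel]
    field_simp
    ring

theorem quasimodeProfile_energy_eq {l : ℕ} (hl : 1 ≤ l) :
    (∫ φ in (0:ℝ)..Real.pi,
      ((deriv (quasimodeProfile l) φ) ^ 2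
        + (l : ℝ) * ((l : ℝ) + 1) * ((Real.sin φ) ^ 2)⁻¹ * (quasimodeProfile l φ) ^ 2)
        * Real.sin φ ^ 2) =
      (2 * (l : ℝ) + 1) * (l + 3) / (4 * (l + 2))
        * ∫ φ in (0:ℝ)..Real.pi, Real.sin φ ^ (2 * l) := by
  simp_rw [quasimodeProfile_energy_density hl]
  have hi (c : ℝ) (n : ℕ) :
      IntervalIntegrable (fun φ => c * Real.sin φ ^ n) volume 0 Real.pi :=
    (by fun_prop : Continuous fun φ => c * Real.sin φ ^ n).intervalIntegrable _ _
  rw [intervalIntegral.integral_add ((hi _ _).sub (hi _ _)) (hi _ _),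
    intervalIntegral.integral_sub (hi _ _) (hi _ _)]
  simp only [intervalIntegral.integral_const_mul]
  rw [integral_sin_pow_two_mul_succ (l + 1), integral_sin_pow_two_mul_succ l]
  push_cast
  field_simp
  ring

/-- The full Dirichlet energy of the quasimode `u_l` on `S³`, expressed in separated form,
is comparable to `l^{1/2}`:
`c l^{1/2} ≤ ∫_0^π (f_l'² + l(l+1) sin⁻²φ f_l²) sin²φ dφ ≤ C l^{1/2}`. -/
theorem quasimode_dirichlet_energy_asymptotics :
    ∃ c > 0, ∃ C > 0, ∀ l : ℕ, 1 ≤ l →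
      c * (l : ℝ) ^ ((1 : ℝ) / 2)
          ≤ (∫ φ in (0:ℝ)..Real.pi,
              ((deriv (quasimodeProfile l) φ) ^ 2
                + (l : ℝ) * ((l : ℝ) + 1) * ((Real.sin φ) ^ 2)⁻¹ * (quasimodeProfile l φ) ^ 2)
                * Real.sin φ ^ 2)
        ∧ (∫ φ in (0:ℝ)..Real.pi,
              ((deriv (quasimodeProfile l) φ) ^ 2
                + (l : ℝ) * ((l : ℝ) + 1) * ((Real.sin φ) ^ 2)⁻¹ * (quasimodeProfile l φ) ^ 2)
                * Real.sin φ ^ 2)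
          ≤ C * (l : ℝ) ^ ((1 : ℝ) / 2) := by
  refine ⟨Real.pi / 4, by positivity, Real.pi, Real.pi_pos, fun l hl => ?_⟩
  rw [quasimodeProfile_energy_eq hl, ← Real.sqrt_eq_rpow]
  have hlo := le_integral_sin_pow_two_mul_sq_mul hl
  have hup := integral_sin_pow_two_mul_sq_mul_le l
  have hA : 0 < ∫ φ in (0:ℝ)..Real.pi, Real.sin φ ^ (2 * l) := integral_sin_pow_pos _
  set A := ∫ φ in (0:ℝ)..Real.pi, Real.sin φ ^ (2 * l)
  have hl1 : (1 : ℝ) ≤ l := by exact_mod_cast hl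
  have hs : √(l : ℝ) ^ 2 = l := Real.sq_sqrt (by positivity)
  have hlo' : Real.pi / 2 ≤ A * √l := by
    refine (sq_le_sq₀ (by positivity) (by positivity)).1 ?_
    rwa [mul_pow, hs]
  have hup' : A * √l ≤ Real.pi := by
    refine (sq_le_sq₀ (by positivity) Real.pi_pos.le).1 ?_
    rw [mul_pow, hs]
    nlinarith [sq_nonneg A]
  have hK_lo : (l : ℝ) / 2 ≤ (2 * (l : ℝ) + 1) * (l + 3) / (4 * (l + 2)) := by
    rw [div_le_div_iff₀ (by positivity) (by positivity)]
    nlinarith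
  have hK_up : (2 * (l : ℝ) + 1) * (l + 3) / (4 * (l + 2)) ≤ l := by
    rw [div_le_iff₀ (by positivity)]
    nlinarith
  constructor
  · calc Real.pi / 4 * √l = Real.pi / 2 * (√l / 2) := by ring
      _ ≤ A * √l * (√l / 2) := by gcongr
      _ = l / 2 * A := by linear_combination A / 2 * hs
      _ ≤ _ := by gcongr
  · calc _ ≤ (l : ℝ) * A := by gcongr
      _ = A * √l * √l := by linear_combination -A * hs
      _ ≤ Real.pi * √l := by gcongr
end
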